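/- Let n ≥ 2, let Ω ⊆ ℝⁿ be a convex domain, and let u ∈ C^∞(Ω) be strictly convex satisfying det(∂²u/∂ξ_i∂ξ_j) = exp(−Σ_{i=1}^n d_i ∂u/∂ξ_i − d_0) on Ω, where d_0, d_1, …, d_n are real constants. Assume that for every real C the sublevel set {ξ ∈ Ω : u(ξ) ≤ C} is a compact subset of Ω (equivalently, u(p) → +∞ as p → ∂Ω). Then Ω = ℝⁿ and u is a quadratic polynomial. -/

import Mathlib

noncomputable section

/-- The `i`-th partial derivative of a function on `ℝⁿ`. -/
def pd {n : ℕ} (i : Fin n) (f : (Fin n → ℝ) → ℝ) : (Fin n → ℝ) → ℝ :=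
  fun x => fderiv ℝ f x (Pi.single i 1)

/-- The Hessian matrix `(∂²f/∂x_i∂x_j)`. -/
def hess {n : ℕ} (f : (Fin n → ℝ) → ℝ) (x : Fin n → ℝ) : Matrix (Fin n) (Fin n) ℝ :=
  Matrix.of fun i j => pd i (pd j f) x

section helpers

open Filter Topology

/-- Two-jet of a one-variable function at zero. -/
def Jet2 (N : ℝ → ℝ) (a b c : ℝ) : Prop :=
  ∃ N1 : ℝ → ℝ, N 0 = a ∧ (∀ᶠ t in 𝓝 (0 : ℝ), HasDerivAt N (N1 t) t) ∧ N1 0 = b ∧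
    HasDerivAt N1 c 0

namespace Jet2

variable {N M : ℝ → ℝ} {a b c a' b' c' : ℝ}

lemma congr (h : Jet2 N a b c) (hNM : ∀ᶠ t in 𝓝 (0 : ℝ), M t = N t) : Jet2 M a b c := by
  obtain ⟨N1, h0, h1, h2, h3⟩ := h
  refine ⟨N1, by rw [hNM.self_of_nhds, h0], ?_, h2, h3⟩
  filter_upwards [h1, hNM.eventually_nhds] with t ht ht'
  exact ht.congr_of_eventuallyEq ht'

lemma cast (h : Jet2 N a b c) (ha : a = a') (hb : b = b') (hc : c = c') : Jet2 N a' b' c' := by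
  subst ha hb hc; exact h

lemma const (a : ℝ) : Jet2 (fun _ => a) a 0 0 :=
  ⟨fun _ => 0, rfl, Eventually.of_forall fun t => hasDerivAt_const t a, rfl, hasDerivAt_const _ _⟩

lemma id : Jet2 (fun t => t) 0 1 0 :=
  ⟨fun _ => 1, rfl, Eventually.of_forall fun t => hasDerivAt_id t, rfl, hasDerivAt_const _ _⟩

lemma add (h : Jet2 N a b c) (h' : Jet2 M a' b' c') :
    Jet2 (fun t => N t + M t) (a + a') (b + b') (c + c') := by
  obtain ⟨N1, h0, h1, h2, h3⟩ := h
  obtain ⟨M1, k0, k1, k2, k3⟩ := h'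
  refine ⟨fun t => N1 t + M1 t, by simp only [h0, k0], ?_, by simp only [h2, k2], h3.add k3⟩
  filter_upwards [h1, k1] with t ht ht'
  exact ht.add ht'

lemma mul (h : Jet2 N a b c) (h' : Jet2 M a' b' c') :
    Jet2 (fun t => N t * M t) (a * a') (b * a' + a * b') (c * a' + 2 * b * b' + a * c') := by
  obtain ⟨N1, h0, h1, h2, h3⟩ := h
  obtain ⟨M1, k0, k1, k2, k3⟩ := h'
  refine ⟨fun t => N1 t * M t + N t * M1 t, by simp only [h0, k0], ?_, by simp only [h2, k2, h0, k0], ?_⟩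
  · filter_upwards [h1, k1] with t ht ht'
    exact ht.mul ht'
  · have := (h3.mul k1.self_of_nhds).add (h1.self_of_nhds.mul k3)
    rw [h0, k0, h2, k2] at this
    exact this.congr_deriv (by ring)

lemma const_mul (r : ℝ) (h : Jet2 N a b c) : Jet2 (fun t => r * N t) (r * a) (r * b) (r * c) :=
  ((const r).mul h).cast rfl (by ring) (by ring)

lemma comp {φ φ1 : ℝ → ℝ} {φ2 : ℝ} (h : Jet2 N a b c)
    (h1 : ∀ᶠ s in 𝓝 a, HasDerivAt φ (φ1 s) s) (h2 : HasDerivAt φ1 φ2 a) :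
    Jet2 (fun t => φ (N t)) (φ a) (φ1 a * b) (φ2 * b ^ 2 + φ1 a * c) := by
  obtain ⟨N1, h0, k1, k2, h3⟩ := h
  subst h0
  have hc : Tendsto N (𝓝 0) (𝓝 (N 0)) := k1.self_of_nhds.continuousAt
  refine ⟨fun t => φ1 (N t) * N1 t, rfl, ?_, by simp only [k2], ?_⟩
  · filter_upwards [k1, hc.eventually h1] with t ht ht'
    exact ht'.comp t ht
  · have := (h2.comp 0 k1.self_of_nhds).mul h3
    rw [k2] at this
    exact this.congr_deriv (by simp; ring)

lemma log (h : Jet2 N a b c) (ha : 0 < a) :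
    Jet2 (fun t => Real.log (N t)) (Real.log a) (b / a) (c / a - (b / a) ^ 2) := by
  refine (h.comp (φ := Real.log) (φ1 := fun s => s⁻¹) (φ2 := -(a ^ 2)⁻¹) ?_ ?_).cast rfl ?_ ?_
  · filter_upwards [lt_mem_nhds ha] with s hs using Real.hasDerivAt_log hs.ne'
  · exact hasDerivAt_inv ha.ne'
  · field_simp
  · field_simp; ring

lemma localMax (h : Jet2 N a b c) (hm : IsLocalMax N 0) : b = 0 ∧ c ≤ 0 := by
  obtain ⟨N1, h0, h1, h2, h3⟩ := h
  have hb : b = 0 := by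
    rw [← h2]; exact hm.hasDerivAt_eq_zero h1.self_of_nhds
  refine ⟨hb, ?_⟩
  by_contra hc
  push Not at hc
  have hd : deriv N =ᶠ[𝓝 0] N1 := by filter_upwards [h1] with t ht using ht.deriv
  have hmin : IsLocalMin N 0 := by
    apply isLocalMin_of_deriv_deriv_pos
    · rw [hd.deriv_eq, h3.deriv]; exact hc
    · rw [hd.self_of_nhds, h2, hb]
    · exact h1.self_of_nhds.continuousAt
  have hconst : ∀ᶠ t in 𝓝 (0 : ℝ), N t = N 0 := by
    filter_upwards [hm, hmin] with t h h' using le_antisymm h h'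
  have hN1 : N1 =ᶠ[𝓝 0] fun _ => 0 := by
    filter_upwards [h1, hconst.eventually_nhds] with t ht ht'
    have := ht.congr_of_eventuallyEq (f₁ := fun _ => N 0)
      (by filter_upwards [ht'] with s hs using hs.symm)
    exact this.unique (hasDerivAt_const _ _)
  have := (h3.congr_of_eventuallyEq hN1.symm).unique (hasDerivAt_const _ _)
  linarith

end Jet2

/-- Directional derivative. -/
def DD {E : Type*} [NormedAddCommGroup E] [NormedSpace ℝ E] (v : E) (f : E → ℝ) : E → ℝ :=
  fun x => fderiv ℝ f x v

section DDsec
variable {E : Type*} [NormedAddCommGroup E] [NormedSpace ℝ E] {Ω : Set E} {f g : E → ℝ}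

lemma DD_smooth (hΩ : IsOpen Ω) (hf : ContDiffOn ℝ (⊤ : ℕ∞) f Ω) (v : E) :
    ContDiffOn ℝ (⊤ : ℕ∞) (DD v f) Ω := by
  have := hf.fderiv_of_isOpen (m := (⊤ : ℕ∞)) hΩ (by simp)
  exact this.clm_apply contDiffOn_const

lemma smooth_diff (hΩ : IsOpen Ω) (hf : ContDiffOn ℝ (⊤ : ℕ∞) f Ω) {x : E} (hx : x ∈ Ω) :
    DifferentiableAt ℝ f x :=
  (hf.contDiffAt (hΩ.mem_nhds hx)).differentiableAt (by simp)

lemma DD_comm (hΩ : IsOpen Ω) (hf : ContDiffOn ℝ (⊤ : ℕ∞) f Ω) (v w : E) {x : E} (hx : x ∈ Ω) :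
    DD v (DD w f) x = DD w (DD v f) x := by
  have h := hf.fderiv_of_isOpen (m := (⊤ : ℕ∞)) hΩ (by simp)
  have hd : DifferentiableAt ℝ (fderiv ℝ f) x :=
    (h.contDiffAt (hΩ.mem_nhds hx)).differentiableAt (by simp)
  have hs : IsSymmSndFDerivAt ℝ f x :=
    (hf.contDiffAt (hΩ.mem_nhds hx)).isSymmSndFDerivAt
      (by simp only [minSmoothness_of_isRCLikeNormedField]; exact WithTop.coe_le_coe.2 (le_top : (2 : ℕ∞) ≤ ⊤))
  have key : ∀ v w : E, DD v (DD w f) x = fderiv ℝ (fderiv ℝ f) x v w := by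
    intro v w
    unfold DD
    rw [fderiv_clm_apply hd (differentiableAt_const _)]
    simp
  rw [key, key]
  exact hs.eq v w

lemma DD_congr (hΩ : IsOpen Ω) (h : Set.EqOn f g Ω) (v : E) : Set.EqOn (DD v f) (DD v g) Ω := by
  intro x hx
  unfold DD
  rw [(h.eventuallyEq_of_mem (hΩ.mem_nhds hx)).fderiv_eq]

lemma DD_add_vec (v w : E) (f : E → ℝ) (x : E) : DD (v + w) f x = DD v f x + DD w f x := by
  simp [DD]

lemma DD_smul_vec (r : ℝ) (v : E) (f : E → ℝ) (x : E) : DD (r • v) f x = r * DD v f x := by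
  simp [DD]

lemma DD_add (hΩ : IsOpen Ω) (hf : ContDiffOn ℝ (⊤ : ℕ∞) f Ω) (hg : ContDiffOn ℝ (⊤ : ℕ∞) g Ω)
    (v : E) {x : E} (hx : x ∈ Ω) : DD v (fun y => f y + g y) x = DD v f x + DD v g x := by
  unfold DD
  rw [fderiv_fun_add (smooth_diff hΩ hf hx) (smooth_diff hΩ hg hx)]
  rfl

lemma DD_const_mul (hΩ : IsOpen Ω) (hf : ContDiffOn ℝ (⊤ : ℕ∞) f Ω) (r : ℝ)
    (v : E) {x : E} (hx : x ∈ Ω) : DD v (fun y => r * f y) x = r * DD v f x := by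
  unfold DD
  rw [fderiv_const_mul (smooth_diff hΩ hf hx)]
  rfl

lemma DD_sum {ι : Type*} (s : Finset ι) {F : ι → E → ℝ} (hΩ : IsOpen Ω)
    (hF : ∀ i, ContDiffOn ℝ (⊤ : ℕ∞) (F i) Ω) (c : ι → ℝ) (v : E) {x : E} (hx : x ∈ Ω) :
    DD v (fun y => ∑ i ∈ s, c i * F i y) x = ∑ i ∈ s, c i * DD v (F i) x := by
  unfold DD
  rw [fderiv_fun_sum (fun i _ => (smooth_diff hΩ (hF i) hx).const_mul (c i))]
  simp only [FunLike.coe_sum, Finset.sum_apply]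
  refine Finset.sum_congr rfl fun i _ => ?_
  rw [fderiv_const_mul (smooth_diff hΩ (hF i) hx)]
  rfl

lemma DD_line (hΩ : IsOpen Ω) (hf : ContDiffOn ℝ (⊤ : ℕ∞) f Ω) (x v : E) (t : ℝ)
    (hx : x + t • v ∈ Ω) : HasDerivAt (fun s : ℝ => f (x + s • v)) (DD v f (x + t • v)) t := by
  have h1 := (smooth_diff hΩ hf hx).hasFDerivAt
  have h2 : HasDerivAt (fun s : ℝ => x + s • v) v t := by
    simpa using ((hasDerivAt_id t).smul_const v).const_add x
  exact h1.comp_hasDerivAt t h2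

lemma line_ev (hΩ : IsOpen Ω) {x : E} (hx : x ∈ Ω) (v : E) :
    ∀ᶠ t in 𝓝 (0 : ℝ), x + t • v ∈ Ω := by
  have hc : Continuous fun t : ℝ => x + t • v := by fun_prop
  exact hc.continuousAt.eventually_mem (by simpa using hΩ.mem_nhds hx)

lemma jet_line (hΩ : IsOpen Ω) (hf : ContDiffOn ℝ (⊤ : ℕ∞) f Ω) {x : E} (hx : x ∈ Ω) (v : E) :
    Jet2 (fun t => f (x + t • v)) (f x) (DD v f x) (DD v (DD v f) x) := by
  refine ⟨fun t => DD v f (x + t • v), by simp, ?_, by simp, ?_⟩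
  · filter_upwards [line_ev hΩ hx v] with t ht using DD_line hΩ hf x v t ht
  · have := DD_line hΩ (DD_smooth hΩ hf v) x v 0 (by simpa using hx)
    simpa using this

end DDsec

section matcalc
attribute [local instance] Matrix.linftyOpNormedRing Matrix.linftyOpNormedAlgebra

variable {n : ℕ}

lemma hasDerivAt_matrix {W : ℝ → Matrix (Fin n) (Fin n) ℝ} {W' : Matrix (Fin n) (Fin n) ℝ} {t : ℝ}
    (h : ∀ a b, HasDerivAt (fun s => W s a b) (W' a b) t) : HasDerivAt W W' t := by
  have hW : W = fun s => ∑ a, ∑ b, (W s a b) • Matrix.single a b (1 : ℝ) := by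
    funext s
    conv_lhs => rw [Matrix.matrix_eq_sum_single (W s)]
    simp [Matrix.smul_single]
  have hW' : W' = ∑ a, ∑ b, (W' a b) • Matrix.single a b (1 : ℝ) := by
    conv_lhs => rw [Matrix.matrix_eq_sum_single W']
    simp [Matrix.smul_single]
  rw [hW, hW']
  refine HasDerivAt.fun_sum fun a _ => HasDerivAt.fun_sum fun b _ => ?_
  exact (h a b).smul_const _

lemma hasDerivAt_entry {W : ℝ → Matrix (Fin n) (Fin n) ℝ} {W' : Matrix (Fin n) (Fin n) ℝ} {t : ℝ}
    (h : HasDerivAt W W' t) (a b : Fin n) : HasDerivAt (fun s => W s a b) (W' a b) t := by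
  let L : Matrix (Fin n) (Fin n) ℝ →L[ℝ] ℝ :=
    LinearMap.toContinuousLinearMap (Matrix.entryLinearMap ℝ ℝ a b)
  exact L.hasFDerivAt.comp_hasDerivAt t h

lemma hasDerivAt_trace {W : ℝ → Matrix (Fin n) (Fin n) ℝ} {W' : Matrix (Fin n) (Fin n) ℝ} {t : ℝ}
    (h : HasDerivAt W W' t) : HasDerivAt (fun s => (W s).trace) W'.trace t := by
  let L : Matrix (Fin n) (Fin n) ℝ →L[ℝ] ℝ :=
    LinearMap.toContinuousLinearMap (Matrix.traceLinearMap (Fin n) ℝ ℝ)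
  exact L.hasFDerivAt.comp_hasDerivAt t h

lemma diff_det (X : Matrix (Fin n) (Fin n) ℝ) :
    DifferentiableAt ℝ (fun X : Matrix (Fin n) (Fin n) ℝ => X.det) X := by
  have : ∀ a b, ContDiff ℝ 1 (fun X : Matrix (Fin n) (Fin n) ℝ => X a b) := fun a b =>
    (LinearMap.toContinuousLinearMap (Matrix.entryLinearMap ℝ ℝ a b)).contDiff
  have h : ContDiff ℝ 1 (fun X : Matrix (Fin n) (Fin n) ℝ => X.det) := by
    simp only [Matrix.det_apply]
    refine ContDiff.sum fun σ _ => ?_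
    refine ContDiff.const_smul _ ?_
    exact contDiff_prod fun i _ => this _ _
  exact (h.differentiable (by simp)) X

lemma fderiv_det_one (M : Matrix (Fin n) (Fin n) ℝ) :
    fderiv ℝ (fun X : Matrix (Fin n) (Fin n) ℝ => X.det) 1 M = M.trace := by
  have h1 : HasDerivAt (fun t : ℝ => (1 : Matrix (Fin n) (Fin n) ℝ) + t • M) M 0 := by
    have := ((hasDerivAt_id (0 : ℝ)).smul_const M).const_add (1 : Matrix (Fin n) (Fin n) ℝ)
    rw [one_smul] at this
    exact this
  have h2 : HasFDerivAt (fun X : Matrix (Fin n) (Fin n) ℝ => X.det)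
      (fderiv ℝ (fun X : Matrix (Fin n) (Fin n) ℝ => X.det) 1)
      ((fun t : ℝ => (1 : Matrix (Fin n) (Fin n) ℝ) + t • M) 0) := by
    simpa using (diff_det 1).hasFDerivAt
  have h3 := h2.comp_hasDerivAt (0 : ℝ) h1
  have h4 : HasDerivAt (fun t : ℝ => ((1 : Matrix (Fin n) (Fin n) ℝ) + t • M).det) M.trace 0 := by
    have hp := (Matrix.det (1 + (Polynomial.X : Polynomial ℝ) • M.map Polynomial.C)).hasDerivAt 0
    rw [Matrix.derivative_det_one_add_X_smul] at hp
    refine hp.congr_of_eventuallyEq (Eventually.of_forall fun t => ?_)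
    simp only
    rw [← Polynomial.coe_evalRingHom, RingHom.map_det]
    congr 1
    ext i j
    simp [Matrix.one_apply, apply_ite]
    ring
  exact h3.unique h4

lemma hasDerivAt_det {W : ℝ → Matrix (Fin n) (Fin n) ℝ} {W' : Matrix (Fin n) (Fin n) ℝ} {t : ℝ}
    (h : HasDerivAt W W' t) (hu : IsUnit (W t).det) :
    HasDerivAt (fun s => (W s).det) ((W t).det * ((W t)⁻¹ * W').trace) t := by
  have h1 : HasDerivAt (fun s => (W t)⁻¹ * W s) ((W t)⁻¹ * W') t := h.const_mul _
  have h2 : HasFDerivAt (fun X : Matrix (Fin n) (Fin n) ℝ => X.det)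
      (fderiv ℝ (fun X : Matrix (Fin n) (Fin n) ℝ => X.det) 1)
      ((fun s => (W t)⁻¹ * W s) t) := by
    simp only [Matrix.nonsing_inv_mul _ hu]
    exact (diff_det 1).hasFDerivAt
  have h3 := (h2.comp_hasDerivAt t h1).const_mul (W t).det
  have h4 := h3.congr_deriv (congrArg ((W t).det * ·) (fderiv_det_one ((W t)⁻¹ * W')))
  refine h4.congr_of_eventuallyEq (Eventually.of_forall fun s => ?_)
  simp only [Function.comp, Matrix.det_mul]
  rw [← mul_assoc, ← Matrix.det_mul, Matrix.mul_nonsing_inv _ hu, Matrix.det_one, one_mul]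

lemma hasDerivAt_inv_mat {W : ℝ → Matrix (Fin n) (Fin n) ℝ} {W' : Matrix (Fin n) (Fin n) ℝ} {t : ℝ}
    (h : HasDerivAt W W' t) (hu : IsUnit (W t).det) :
    HasDerivAt (fun s => (W s)⁻¹) (-((W t)⁻¹ * W' * (W t)⁻¹)) t := by
  obtain ⟨x, hx⟩ := (Matrix.isUnit_iff_isUnit_det _).2 hu
  have h1 := hasFDerivAt_ringInverse (𝕜 := ℝ) x
  rw [hx] at h1
  have h2 := h1.comp_hasDerivAt t h
  have h3 : ((x⁻¹ : (Matrix (Fin n) (Fin n) ℝ)ˣ) : Matrix (Fin n) (Fin n) ℝ) = (W t)⁻¹ := by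
    rw [Matrix.coe_units_inv, hx]
  simp only [Function.comp_def, ← Matrix.nonsing_inv_eq_ringInverse] at h2
  refine h2.congr_deriv ?_
  simp [h3]

/-- Derivatives of `log det`. -/
lemma logdet_derivs {W W1 W2 W3 : ℝ → Matrix (Fin n) (Fin n) ℝ} {g g1 g2 g3 : ℝ → ℝ}
    (hW : ∀ᶠ t in 𝓝 (0 : ℝ), ∀ a b, HasDerivAt (fun s => W s a b) (W1 t a b) t)
    (hW1 : ∀ᶠ t in 𝓝 (0 : ℝ), ∀ a b, HasDerivAt (fun s => W1 s a b) (W2 t a b) t)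
    (hW2 : ∀ᶠ t in 𝓝 (0 : ℝ), ∀ a b, HasDerivAt (fun s => W2 s a b) (W3 t a b) t)
    (hg : ∀ᶠ t in 𝓝 (0 : ℝ), HasDerivAt g (g1 t) t)
    (hg1 : ∀ᶠ t in 𝓝 (0 : ℝ), HasDerivAt g1 (g2 t) t)
    (hg2 : ∀ᶠ t in 𝓝 (0 : ℝ), HasDerivAt g2 (g3 t) t)
    (hdet : ∀ᶠ t in 𝓝 (0 : ℝ), (W t).det = Real.exp (g t)) (hW0 : W 0 = 1) :
    (W1 0).trace = g1 0 ∧ (W2 0).trace - (W1 0 * W1 0).trace = g2 0 ∧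
    (W3 0).trace - 3 * (W1 0 * W2 0).trace + 2 * (W1 0 * W1 0 * W1 0).trace = g3 0 := by
  have hu : ∀ᶠ t in 𝓝 (0 : ℝ), IsUnit (W t).det := by
    filter_upwards [hdet] with t ht
    rw [ht]; exact (Real.exp_pos _).ne'.isUnit
  have e1 : ∀ᶠ t in 𝓝 (0 : ℝ), ((W t)⁻¹ * W1 t).trace = g1 t := by
    filter_upwards [hW, hu, hg, hdet, hdet.eventually_nhds] with t h1 h2 h3 h4 h5
    have k1 := hasDerivAt_det (hasDerivAt_matrix h1) h2
    have k2 := h3.exp.congr_of_eventuallyEq h5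
    have := k1.unique k2
    rw [h4] at this
    exact mul_left_cancel₀ (Real.exp_pos _).ne' this
  have d1 : ∀ᶠ t in 𝓝 (0 : ℝ), HasDerivAt (fun s => (W s)⁻¹ * W1 s)
      (-((W t)⁻¹ * W1 t * (W t)⁻¹) * W1 t + (W t)⁻¹ * W2 t) t := by
    filter_upwards [hW, hu, hW1] with t h1 h2 h3
    exact (hasDerivAt_inv_mat (hasDerivAt_matrix h1) h2).mul (hasDerivAt_matrix h3)
  have e2 : ∀ᶠ t in 𝓝 (0 : ℝ),
      (-((W t)⁻¹ * W1 t * (W t)⁻¹) * W1 t + (W t)⁻¹ * W2 t).trace = g2 t := by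
    filter_upwards [d1, hg1, e1.eventually_nhds] with t h1 h2 h3
    exact (hasDerivAt_trace h1).unique (h2.congr_of_eventuallyEq h3)
  have d2 : HasDerivAt (fun s => (-((W s)⁻¹ * W1 s * (W s)⁻¹) * W1 s + (W s)⁻¹ * W2 s))
      (W3 0 - (W1 0 * W2 0 + W2 0 * W1 0 + W1 0 * W2 0) + (2 : ℝ) • (W1 0 * W1 0 * W1 0)) 0 := by
    have i0 := hasDerivAt_inv_mat (hasDerivAt_matrix hW.self_of_nhds) hu.self_of_nhds
    have i1 := hasDerivAt_matrix hW1.self_of_nhds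
    have i2 := hasDerivAt_matrix hW2.self_of_nhds
    have := (((i0.mul i1).mul i0).neg.mul i1).add (i0.mul i2)
    refine this.congr_deriv ?_
    simp only [hW0, inv_one, one_mul, mul_one, Pi.mul_apply, Pi.neg_apply]
    rw [two_smul]
    noncomm_ring
  have e3 := (hasDerivAt_trace d2).unique (hg2.self_of_nhds.congr_of_eventuallyEq e2)
  have a1 := e1.self_of_nhds
  have a2 := e2.self_of_nhds
  simp only [hW0, inv_one, one_mul, mul_one] at a1 a2
  refine ⟨a1, ?_, ?_⟩
  · rw [← a2]; simp [Matrix.trace_add]; ring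
  · rw [← e3]
    simp only [Matrix.trace_add, Matrix.trace_sub, Matrix.trace_smul, smul_eq_mul]
    rw [Matrix.trace_mul_comm (W2 0) (W1 0)]
    ring

end matcalc

/-- Orthonormal frame for a positive definite matrix with prescribed first vector. -/
lemma exists_frame {n : ℕ} {U : Matrix (Fin n) (Fin n) ℝ} (hU : U.PosDef) (e : Fin n → ℝ)
    (he : e ⬝ᵥ (U.mulVec e) = 1) (i0 : Fin n) :
    ∃ V : Fin n → (Fin n → ℝ), V i0 = e ∧
      ∀ a b, V a ⬝ᵥ (U.mulVec (V b)) = if a = b then 1 else 0 := by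
  obtain ⟨B, hB, hBU⟩ : ∃ B : Matrix (Fin n) (Fin n) ℝ, IsUnit B ∧ U = B.transpose * B := by
    open scoped MatrixOrder in
    obtain ⟨B, hB⟩ := CStarAlgebra.nonneg_iff_eq_star_mul_self.mp hU.posSemidef.nonneg
    refine ⟨B, ?_, by rw [hB, Matrix.star_eq_conjTranspose, Matrix.conjTranspose_eq_transpose_of_trivial]⟩
    rw [Matrix.isUnit_iff_isUnit_det]
    have h1 := hU.det_pos
    rw [hB, Matrix.det_mul] at h1
    refine IsUnit.mk0 _ fun h0 => ?_
    rw [h0, mul_zero] at h1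
    exact lt_irrefl _ h1
  have hip : ∀ x y : Fin n → ℝ, x ⬝ᵥ (U.mulVec y) =
      inner ℝ (WithLp.toLp 2 (B.mulVec x)) (WithLp.toLp 2 (B.mulVec y)) := by
    intro x y
    rw [hBU, ← Matrix.mulVec_mulVec, Matrix.dotProduct_mulVec, Matrix.vecMul_transpose,
      EuclideanSpace.inner_toLp_toLp, dotProduct_comm]
    simp
  let w : Fin n → EuclideanSpace ℝ (Fin n) := fun _ => WithLp.toLp 2 (B.mulVec e)
  have hw : Orthonormal ℝ (({i0} : Set (Fin n)).domRestrict w) := by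
    constructor
    · intro i
      have : ‖w i0‖ ^ 2 = 1 := by
        rw [← real_inner_self_eq_norm_sq, ← hip, he]
      have h2 : ‖w i0‖ = 1 := by
        nlinarith [norm_nonneg (w i0)]
      exact h2
    · intro i j hij
      exact absurd (Subsingleton.elim i j) hij
  obtain ⟨bs, hbs⟩ := hw.exists_orthonormalBasis_extension_of_card_eq (by simp)
  have hBB : B * B⁻¹ = 1 := Matrix.mul_nonsing_inv _ ((Matrix.isUnit_iff_isUnit_det _).1 hB)
  have hBB' : B⁻¹ * B = 1 := Matrix.nonsing_inv_mul _ ((Matrix.isUnit_iff_isUnit_det _).1 hB)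
  refine ⟨fun a => B⁻¹.mulVec (bs a).ofLp, ?_, fun a b => ?_⟩
  · simp only
    rw [hbs i0 rfl]
    simp [w, Matrix.mulVec_mulVec, hBB']
  · rw [hip]
    simp only [Matrix.mulVec_mulVec, hBB, Matrix.one_mulVec, WithLp.toLp_ofLp]
    exact bs.inner_eq_ite a b

section infra
variable {n : ℕ} {Ω : Set (Fin n → ℝ)} {u f : (Fin n → ℝ) → ℝ}

lemma DD_zero_vec (f : (Fin n → ℝ) → ℝ) (x : Fin n → ℝ) : DD (0 : Fin n → ℝ) f x = 0 := by
  simp [DD]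

lemma DD_sum_vec {ι : Type*} (s : Finset ι) (c : ι → ℝ) (V : ι → (Fin n → ℝ))
    (f : (Fin n → ℝ) → ℝ) (x : Fin n → ℝ) :
    DD (∑ i ∈ s, c i • V i) f x = ∑ i ∈ s, c i * DD (V i) f x := by
  simp [DD, map_sum]

lemma DD_eq_pd (v : Fin n → ℝ) (f : (Fin n → ℝ) → ℝ) (x : Fin n → ℝ) :
    DD v f x = ∑ i, v i * pd i f x := by
  have h : v = ∑ i, v i • (Pi.single i (1 : ℝ) : Fin n → ℝ) := by
    ext j
    simp [Finset.sum_apply, Pi.single_apply]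
  conv_lhs => rw [h]
  rw [DD_sum_vec]
  rfl

lemma DD_sum_vec2 (hΩ : IsOpen Ω) (hf : ContDiffOn ℝ (⊤ : ℕ∞) f Ω) {ι : Type*} (s : Finset ι)
    (c : ι → ℝ) (V : ι → (Fin n → ℝ)) (w : Fin n → ℝ) {x : Fin n → ℝ} (hx : x ∈ Ω) :
    DD w (DD (∑ i ∈ s, c i • V i) f) x = ∑ i ∈ s, c i * DD w (DD (V i) f) x := by
  rw [← DD_sum s hΩ (fun i => DD_smooth hΩ hf (V i)) c w hx]
  congr 1
  funext y
  exact DD_sum_vec s c V f y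

lemma DD_hess (hΩ : IsOpen Ω) (hu : ContDiffOn ℝ (⊤ : ℕ∞) u Ω) (v w : Fin n → ℝ)
    {x : Fin n → ℝ} (hx : x ∈ Ω) : DD v (DD w u) x = v ⬝ᵥ ((hess u x).mulVec w) := by
  rw [DD_eq_pd]
  simp only [dotProduct, Matrix.mulVec]
  refine Finset.sum_congr rfl fun i _ => ?_
  congr 1
  have h : DD w u = fun y => ∑ j, w j * pd j u y := funext fun y => DD_eq_pd w u y
  have h2 : pd i (DD w u) x = ∑ j, w j * pd i (pd j u) x := by
    rw [h]
    exact DD_sum Finset.univ hΩ (fun j => DD_smooth hΩ hu (Pi.single j 1)) w (Pi.single i 1) hx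
  rw [h2]
  exact Finset.sum_congr rfl fun j _ => by simp [hess, mul_comm]

lemma DD_comm3 (hΩ : IsOpen Ω) (hf : ContDiffOn ℝ (⊤ : ℕ∞) f Ω) (e a b : Fin n → ℝ)
    {x : Fin n → ℝ} (hx : x ∈ Ω) : DD e (DD a (DD b f)) x = DD a (DD b (DD e f)) x := by
  rw [DD_comm hΩ (DD_smooth hΩ hf b) e a hx]
  exact DD_congr hΩ (fun y hy => DD_comm hΩ hf e b hy) a hx

/-- The PDE differentiated in direction `e`, written in an orthonormal frame. -/
lemma pde_frame (hΩ : IsOpen Ω) (hu : ContDiffOn ℝ (⊤ : ℕ∞) u Ω)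
    (d : Fin n → ℝ) (d0 : ℝ)
    (hpde : ∀ ξ ∈ Ω, (hess u ξ).det = Real.exp (-(∑ i : Fin n, d i * pd i u ξ) - d0))
    {x : Fin n → ℝ} (hx : x ∈ Ω) (V : Fin n → (Fin n → ℝ))
    (hV : ∀ a b, DD (V a) (DD (V b) u) x = if a = b then 1 else 0) (e : Fin n → ℝ) :
    (∑ a, DD (V a) (DD (V a) (DD e u)) x = - DD d (DD e u) x) ∧
    (∑ a, DD (V a) (DD (V a) (DD e (DD e u))) x -
      ∑ a, ∑ b, (DD (V a) (DD (V b) (DD e u)) x) ^ 2 = - DD d (DD e (DD e u)) x) ∧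
    (∑ a, DD (V a) (DD (V a) (DD e (DD e (DD e u)))) x -
      3 * ∑ a, ∑ b, (DD (V a) (DD (V b) (DD e u)) x) * (DD (V a) (DD (V b) (DD e (DD e u))) x) +
      2 * ∑ a, ∑ b, ∑ c, (DD (V a) (DD (V b) (DD e u)) x) * (DD (V a) (DD (V c) (DD e u)) x)
        * (DD (V b) (DD (V c) (DD e u)) x)
      = - DD d (DD e (DD e (DD e u))) x) := by
  have hs1 := DD_smooth hΩ hu e
  have hs2 := DD_smooth hΩ hs1 e
  have hs3 := DD_smooth hΩ hs2 e
  let W : ((Fin n → ℝ) → ℝ) → ℝ → Matrix (Fin n) (Fin n) ℝ := fun f t =>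
    Matrix.of fun a b => DD (V a) (DD (V b) f) (x + t • e)
  have hWd : ∀ f, ContDiffOn ℝ (⊤ : ℕ∞) f Ω → ∀ᶠ t in 𝓝 (0 : ℝ), ∀ a b,
      HasDerivAt (fun s => W f s a b) (W (DD e f) t a b) t := by
    intro f hf
    filter_upwards [line_ev hΩ hx e] with t ht a b
    have := DD_line hΩ (DD_smooth hΩ (DD_smooth hΩ hf (V b)) (V a)) x e t ht
    rw [DD_comm3 hΩ hf e (V a) (V b) ht] at this
    exact this
  let Vm : Matrix (Fin n) (Fin n) ℝ := Matrix.of V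
  have hWdet : ∀ᶠ t in 𝓝 (0 : ℝ), (W u t).det = Vm.det ^ 2 * (hess u (x + t • e)).det := by
    filter_upwards [line_ev hΩ hx e] with t ht
    have : W u t = Vm * hess u (x + t • e) * Vm.transpose := by
      ext a b
      simp only [W, Matrix.of_apply]
      rw [DD_hess hΩ hu (V a) (V b) ht, Matrix.mul_apply_eq_vecMul, Matrix.dotProduct_mulVec]
      simp only [Matrix.mul_apply, Matrix.vecMul, dotProduct, Vm, Matrix.of_apply,
        Matrix.transpose_apply]
    rw [this, Matrix.det_mul, Matrix.det_mul, Matrix.det_transpose]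
    ring
  have hW0 : W u 0 = 1 := by
    ext a b
    simp [W, hV, Matrix.one_apply]
  have hpos : 0 < Vm.det ^ 2 := by
    have h1 := hWdet.self_of_nhds
    rw [hW0, Matrix.det_one] at h1
    rcases (sq_nonneg Vm.det).lt_or_eq with h | h
    · exact h
    · rw [← h] at h1; simp at h1
  let g : ((Fin n → ℝ) → ℝ) → ℝ → ℝ := fun f t => - DD d f (x + t • e)
  have hgd : ∀ f, ContDiffOn ℝ (⊤ : ℕ∞) f Ω → ∀ᶠ t in 𝓝 (0 : ℝ),
      HasDerivAt (g f) (g (DD e f) t) t := by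
    intro f hf
    filter_upwards [line_ev hΩ hx e] with t ht
    have := (DD_line hΩ (DD_smooth hΩ hf d) x e t ht).neg
    rw [DD_comm hΩ hf e d ht] at this
    exact this
  have hdet : ∀ᶠ t in 𝓝 (0 : ℝ), (W u t).det =
      Real.exp (g u t + (-d0 + Real.log (Vm.det ^ 2))) := by
    filter_upwards [hWdet, line_ev hΩ hx e] with t h1 h2
    rw [h1, hpde _ h2, ← DD_eq_pd, ← add_assoc, Real.exp_add _ (Real.log _), Real.exp_log hpos,
      mul_comm]
    rfl
  obtain ⟨r1, r2, r3⟩ := logdet_derivs (hWd u hu) (hWd _ hs1) (hWd _ hs2)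
    ((hgd u hu).mono fun t ht => ht.add_const _) (hgd _ hs1) (hgd _ hs2) hdet hW0
  have hW00 : ∀ f a b, W f 0 a b = DD (V a) (DD (V b) f) x := by
    intro f a b; simp [W]
  have hg00 : ∀ f, g f 0 = - DD d f x := by intro f; simp [g]
  have hsym : ∀ f, ContDiffOn ℝ (⊤ : ℕ∞) f Ω → ∀ a b, DD (V a) (DD (V b) f) x =
      DD (V b) (DD (V a) f) x := fun f hf a b => DD_comm hΩ hf _ _ hx
  simp only [Matrix.trace, Matrix.diag, Matrix.mul_apply, hW00, hg00] at r1 r2 r3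
  refine ⟨r1, ?_, ?_⟩
  · rw [← r2]
    congr 1
    refine Finset.sum_congr rfl fun a _ => Finset.sum_congr rfl fun b _ => ?_
    rw [hsym _ hs1 b a, sq]
  · rw [← r3]
    congr 2
    · congr 1
      refine Finset.sum_congr rfl fun a _ => Finset.sum_congr rfl fun b _ => ?_
      rw [hsym _ hs2 b a]
    · refine Finset.sum_congr rfl fun a _ => ?_
      simp only [Finset.sum_mul]
      rw [Finset.sum_comm]
      refine Finset.sum_congr rfl fun b _ => Finset.sum_congr rfl fun c _ => ?_
      rw [hsym _ hs1 b a]; ring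

/-- Joint jets. -/
lemma jet_N1 (hΩ : IsOpen Ω) (hu : ContDiffOn ℝ (⊤ : ℕ∞) u Ω) {x : Fin n → ℝ} (hx : x ∈ Ω)
    (e b v : Fin n → ℝ) :
    Jet2 (fun t => DD (e + t • b) u (x + t • v)) (DD e u x) (DD v (DD e u) x + DD b u x)
      (DD v (DD v (DD e u)) x + 2 * DD v (DD b u) x) := by
  have h1 := jet_line hΩ (DD_smooth hΩ hu e) hx v
  have h2 := jet_line hΩ (DD_smooth hΩ hu b) hx v
  refine ((h1.add (Jet2.id.mul h2)).cast (by ring) (by ring) (by ring)).congr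
    (Eventually.of_forall fun t => ?_)
  rw [DD_add_vec, DD_smul_vec]

lemma DD2_expand (hΩ : IsOpen Ω) (hu : ContDiffOn ℝ (⊤ : ℕ∞) u Ω) {x : Fin n → ℝ} (hx : x ∈ Ω)
    (e b : Fin n → ℝ) (t : ℝ) :
    DD (e + t • b) (DD (e + t • b) u) x =
      DD e (DD e u) x + (2 * t) * DD e (DD b u) x + t ^ 2 * DD b (DD b u) x := by
  have h : DD (e + t • b) u = fun y => DD e u y + t * DD b u y := by
    funext y; rw [DD_add_vec, DD_smul_vec]
  have he := DD_smooth hΩ hu e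
  have hb := DD_smooth hΩ hu b
  have hk : ∀ w : Fin n → ℝ, DD w (DD (e + t • b) u) x = DD w (DD e u) x + t * DD w (DD b u) x := by
    intro w
    rw [h, DD_add hΩ he (contDiffOn_const.mul hb) w hx, DD_const_mul hΩ hb t w hx]
  rw [DD_add_vec, DD_smul_vec, hk, hk, DD_comm hΩ hu b e hx]
  ring

lemma DD3_expand (hΩ : IsOpen Ω) (hu : ContDiffOn ℝ (⊤ : ℕ∞) u Ω) {x : Fin n → ℝ} (hx : x ∈ Ω)
    (e b : Fin n → ℝ) (t : ℝ) :
    DD (e + t • b) (DD (e + t • b) (DD (e + t • b) u)) x =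
      DD e (DD e (DD e u)) x + (3 * t) * DD b (DD e (DD e u)) x
        + (3 * t ^ 2) * DD b (DD b (DD e u)) x + t ^ 3 * DD b (DD b (DD b u)) x := by
  have h : DD (e + t • b) u = fun y => DD e u y + t * DD b u y := by
    funext y; rw [DD_add_vec, DD_smul_vec]
  have he := DD_smooth hΩ hu e
  have hb := DD_smooth hΩ hu b
  have hs : ContDiffOn ℝ (⊤ : ℕ∞) (DD (e + t • b) u) Ω := DD_smooth hΩ hu _
  rw [DD2_expand hΩ hs hx e b t]
  have hk : ∀ w z : Fin n → ℝ, DD w (DD z (DD (e + t • b) u)) x =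
      DD w (DD z (DD e u)) x + t * DD w (DD z (DD b u)) x := by
    intro w z
    have h1 : Set.EqOn (DD z (DD (e + t • b) u))
        (fun y => DD z (DD e u) y + t * DD z (DD b u) y) Ω := by
      intro y hy
      rw [h, DD_add hΩ he (contDiffOn_const.mul hb) z hy, DD_const_mul hΩ hb t z hy]
    rw [DD_congr hΩ h1 w hx, DD_add hΩ (DD_smooth hΩ he z)
      (contDiffOn_const.mul (DD_smooth hΩ hb z)) w hx, DD_const_mul hΩ (DD_smooth hΩ hb z) t w hx]
  rw [hk, hk, hk]
  have c1 : DD e (DD b (DD e u)) x = DD b (DD e (DD e u)) x := DD_comm hΩ he e b hx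
  have c2 : DD e (DD e (DD b u)) x = DD b (DD e (DD e u)) x :=
    (DD_comm3 hΩ hu b e e hx).symm
  have c3 : DD e (DD b (DD b u)) x = DD b (DD b (DD e u)) x := DD_comm3 hΩ hu e b b hx
  rw [c1, c2, c3]
  ring

lemma jet_D (hΩ : IsOpen Ω) (hu : ContDiffOn ℝ (⊤ : ℕ∞) u Ω) {x : Fin n → ℝ} (hx : x ∈ Ω)
    (e b v : Fin n → ℝ) :
    Jet2 (fun t => DD (e + t • b) (DD (e + t • b) u) (x + t • v)) (DD e (DD e u) x)
      (DD v (DD e (DD e u)) x + 2 * DD b (DD e u) x)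
      (DD v (DD v (DD e (DD e u))) x + 4 * DD v (DD b (DD e u)) x + 2 * DD b (DD b u) x) := by
  have h1 := jet_line hΩ (DD_smooth hΩ (DD_smooth hΩ hu e) e) hx v
  have h2 := jet_line hΩ (DD_smooth hΩ (DD_smooth hΩ hu b) e) hx v
  have h3 := jet_line hΩ (DD_smooth hΩ (DD_smooth hΩ hu b) b) hx v
  have c1 : DD e (DD b u) x = DD b (DD e u) x := DD_comm hΩ hu e b hx
  have c2 : DD v (DD e (DD b u)) x = DD v (DD b (DD e u)) x :=
    DD_congr hΩ (fun y hy => DD_comm hΩ hu e b hy) v hx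
  refine (((h1.add ((Jet2.id.const_mul 2).mul h2)).add ((Jet2.id.mul Jet2.id).mul h3)).cast
    (by ring) (by rw [c1]; ring) (by rw [c2]; ring)).congr ?_
  filter_upwards [line_ev hΩ hx v] with t ht
  rw [DD2_expand hΩ hu ht]
  ring

lemma jet_N3 (hΩ : IsOpen Ω) (hu : ContDiffOn ℝ (⊤ : ℕ∞) u Ω) {x : Fin n → ℝ} (hx : x ∈ Ω)
    (e b v : Fin n → ℝ) :
    Jet2 (fun t => DD (e + t • b) (DD (e + t • b) (DD (e + t • b) u)) (x + t • v))
      (DD e (DD e (DD e u)) x)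
      (DD v (DD e (DD e (DD e u))) x + 3 * DD b (DD e (DD e u)) x)
      (DD v (DD v (DD e (DD e (DD e u)))) x + 6 * DD v (DD b (DD e (DD e u))) x
        + 6 * DD b (DD b (DD e u)) x) := by
  have he := DD_smooth hΩ hu e
  have hb := DD_smooth hΩ hu b
  have h1 := jet_line hΩ (DD_smooth hΩ (DD_smooth hΩ he e) e) hx v
  have h2 := jet_line hΩ (DD_smooth hΩ (DD_smooth hΩ he e) b) hx v
  have h3 := jet_line hΩ (DD_smooth hΩ (DD_smooth hΩ he b) b) hx v
  have h4 := jet_line hΩ (DD_smooth hΩ (DD_smooth hΩ hb b) b) hx v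
  refine ((((h1.add ((Jet2.id.const_mul 3).mul h2)).add
    (((Jet2.id.mul Jet2.id).const_mul 3).mul h3)).add
    ((Jet2.id.mul (Jet2.id.mul Jet2.id)).mul h4)).cast
    (by ring) (by ring) (by ring)).congr ?_
  filter_upwards [line_ev hΩ hx v] with t ht
  rw [DD3_expand hΩ hu ht]
  ring

lemma DD_cont (hΩ : IsOpen Ω) (hu : ContDiffOn ℝ (⊤ : ℕ∞) u Ω) :
    ContinuousOn (fun p : (Fin n → ℝ) × (Fin n → ℝ) => DD p.2 u p.1) (Ω ×ˢ Set.univ) := by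
  simp only [DD_eq_pd]
  refine continuousOn_finsetSum _ fun i _ => ?_
  refine ContinuousOn.mul (by fun_prop) ?_
  exact (DD_smooth hΩ hu (Pi.single i 1)).continuousOn.comp continuousOn_fst (fun p hp => hp.1)

lemma DD2_cont (hΩ : IsOpen Ω) (hu : ContDiffOn ℝ (⊤ : ℕ∞) u Ω) :
    ContinuousOn (fun p : (Fin n → ℝ) × (Fin n → ℝ) => DD p.2 (DD p.2 u) p.1)
      (Ω ×ˢ Set.univ) := by
  have h : ∀ p ∈ Ω ×ˢ (Set.univ : Set (Fin n → ℝ)), DD p.2 (DD p.2 u) p.1 =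
      ∑ i, p.2 i * DD p.2 (pd i u) p.1 := by
    intro p hp
    have h1 : DD p.2 u = fun y => ∑ i, p.2 i * pd i u y := funext fun y => DD_eq_pd _ _ _
    rw [h1]
    exact DD_sum Finset.univ hΩ (fun i => DD_smooth hΩ hu (Pi.single i 1)) p.2 p.2 hp.1
  refine ContinuousOn.congr ?_ h
  refine continuousOn_finsetSum _ fun i _ => ?_
  exact ContinuousOn.mul (by fun_prop) (DD_cont hΩ (DD_smooth hΩ hu (Pi.single i 1)))

lemma DD3_cont (hΩ : IsOpen Ω) (hu : ContDiffOn ℝ (⊤ : ℕ∞) u Ω) :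
    ContinuousOn (fun p : (Fin n → ℝ) × (Fin n → ℝ) => DD p.2 (DD p.2 (DD p.2 u)) p.1)
      (Ω ×ˢ Set.univ) := by
  have h : ∀ p ∈ Ω ×ˢ (Set.univ : Set (Fin n → ℝ)), DD p.2 (DD p.2 (DD p.2 u)) p.1 =
      ∑ i, p.2 i * DD p.2 (DD p.2 (pd i u)) p.1 := by
    intro p hp
    have h1 : DD p.2 u = fun y => ∑ i, p.2 i * pd i u y := funext fun y => DD_eq_pd _ _ _
    have h2 : Set.EqOn (DD p.2 (DD p.2 u)) (fun y => ∑ i, p.2 i * DD p.2 (pd i u) y) Ω := by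
      intro y hy
      rw [h1]
      exact DD_sum Finset.univ hΩ (fun i => DD_smooth hΩ hu (Pi.single i 1)) p.2 p.2 hy
    rw [DD_congr hΩ h2 p.2 hp.1]
    exact DD_sum Finset.univ hΩ (fun i => DD_smooth hΩ (DD_smooth hΩ hu (Pi.single i 1)) p.2)
      p.2 p.2 hp.1
  refine ContinuousOn.congr ?_ h
  refine continuousOn_finsetSum _ fun i _ => ?_
  exact ContinuousOn.mul (by fun_prop) (DD2_cont hΩ (DD_smooth hΩ hu (Pi.single i 1)))

/-- Maximum of a degree-zero homogeneous quotient. -/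
lemma exists_max_quot (hn : 0 < n) {K : Set (Fin n → ℝ)} (hK : IsCompact K) (hKne : K.Nonempty)
    (num D : (Fin n → ℝ) → (Fin n → ℝ) → ℝ) (k : ℕ) (hk : k ≠ 0)
    (hnc : ContinuousOn (fun p : (Fin n → ℝ) × (Fin n → ℝ) => num p.1 p.2) (K ×ˢ Set.univ))
    (hDc : ContinuousOn (fun p : (Fin n → ℝ) × (Fin n → ℝ) => D p.1 p.2) (K ×ˢ Set.univ))
    (hD : ∀ x ∈ K, ∀ e, e ≠ 0 → 0 < D x e)
    (hnh : ∀ x ∈ K, ∀ e, ∀ r : ℝ, num x (r • e) = (r ^ 2) ^ k * num x e)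
    (hDh : ∀ x ∈ K, ∀ e, ∀ r : ℝ, D x (r • e) = r ^ 2 * D x e) :
    ∃ x0 ∈ K, ∃ e0, D x0 e0 = 1 ∧ ∀ x ∈ K, ∀ e, num x e ≤ num x0 e0 * D x e ^ k := by
  have : Nonempty (Fin n) := ⟨⟨0, hn⟩⟩
  have hS : IsCompact (Metric.sphere (0 : Fin n → ℝ) 1) := isCompact_sphere _ _
  have hSne : (Metric.sphere (0 : Fin n → ℝ) 1).Nonempty := by
    refine ⟨fun _ => 1, ?_⟩
    simp
  have hne : ∀ e ∈ Metric.sphere (0 : Fin n → ℝ) 1, e ≠ 0 := by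
    intro e he h0
    simp [h0] at he
  have hsub : K ×ˢ Metric.sphere (0 : Fin n → ℝ) 1 ⊆ K ×ˢ Set.univ :=
    Set.prod_mono le_rfl (Set.subset_univ _)
  obtain ⟨p, hp, hmax⟩ := (hK.prod hS).exists_isMaxOn (hKne.prod hSne)
    (f := fun p : (Fin n → ℝ) × (Fin n → ℝ) => num p.1 p.2 / D p.1 p.2 ^ k)
    ((hnc.mono hsub).div ((hDc.mono hsub).pow k)
      (fun q hq => pow_ne_zero _ (hD q.1 hq.1 q.2 (hne _ hq.2)).ne'))
  have hDp := hD p.1 hp.1 p.2 (hne _ hp.2)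
  have hsq : ((Real.sqrt (D p.1 p.2))⁻¹) ^ 2 = (D p.1 p.2)⁻¹ := by
    rw [inv_pow, Real.sq_sqrt hDp.le]
  refine ⟨p.1, hp.1, (Real.sqrt (D p.1 p.2))⁻¹ • p.2, ?_, ?_⟩
  · rw [hDh p.1 hp.1, hsq]
    exact inv_mul_cancel₀ hDp.ne'
  · intro x hx e
    rw [hnh p.1 hp.1, hsq]
    by_cases he : e = 0
    · have h1 := hnh x hx e 0
      have h2 := hDh x hx e 0
      simp [he, hk] at h1 h2
      rw [he, h1, h2]
      simp [hk]
    · have hnorm : ‖e‖ ≠ 0 := by simpa using he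
      have hs : ‖e‖⁻¹ • e ∈ Metric.sphere (0 : Fin n → ℝ) 1 := by
        simp [norm_smul, hnorm]
      have h1 := hmax (show (x, ‖e‖⁻¹ • e) ∈ K ×ˢ Metric.sphere (0 : Fin n → ℝ) 1 from ⟨hx, hs⟩)
      simp only [Set.mem_ofPred_eq] at h1
      rw [hnh x hx, hDh x hx, mul_pow, mul_div_mul_left _ _
        (pow_ne_zero _ (pow_ne_zero _ (inv_ne_zero hnorm)))] at h1
      have hDe := pow_pos (hD x hx e he) k
      rw [div_le_iff₀ hDe] at h1
      rw [inv_pow, inv_mul_eq_div]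
      exact h1

end infra

section concl
variable {n : ℕ} {Ω : Set (Fin n → ℝ)} {u f : (Fin n → ℝ) → ℝ}

lemma taylor_third_zero (hΩ : IsOpen Ω) (hc : Convex ℝ Ω) (hu : ContDiffOn ℝ (⊤ : ℕ∞) u Ω)
    (h3 : ∀ x ∈ Ω, ∀ e, DD e (DD e (DD e u)) x = 0) {p ξ : Fin n → ℝ} (hp : p ∈ Ω) (hξ : ξ ∈ Ω) :
    u ξ = u p + DD (ξ - p) u p + 1 / 2 * DD (ξ - p) (DD (ξ - p) u) p := by
  set v := ξ - p with hv
  have hin : ∀ t ∈ Set.Icc (0 : ℝ) 1, p + t • v ∈ Ω := by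
    intro t ht
    have := hc hp hξ (sub_nonneg.2 ht.2) ht.1 (by ring)
    convert this using 1
    rw [hv, sub_smul, one_smul, smul_sub]; abel
  let h : ℝ → ℝ := fun t => u (p + t • v) + (1 - t) * DD v u (p + t • v) +
    (1 - t) ^ 2 / 2 * DD v (DD v u) (p + t • v)
  have hd : ∀ t ∈ Set.Icc (0 : ℝ) 1, HasDerivAt h 0 t := by
    intro t ht
    have e1 := DD_line hΩ hu p v t (hin t ht)
    have e2 := DD_line hΩ (DD_smooth hΩ hu v) p v t (hin t ht)
    have e3 := DD_line hΩ (DD_smooth hΩ (DD_smooth hΩ hu v) v) p v t (hin t ht)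
    rw [h3 _ (hin t ht) v] at e3
    have l : HasDerivAt (fun t : ℝ => 1 - t) (-1) t := by
      simpa using (hasDerivAt_id t).const_sub 1
    have := (e1.add (l.mul e2)).add (((l.pow 2).div_const 2).mul e3)
    refine (this.congr_deriv ?_)
    simp
    ring
  have hk := constant_of_has_deriv_right_zero (f := h) (a := 0) (b := 1)
    (fun t ht => (hd t ht).continuousAt.continuousWithinAt)
    (fun t ht => (hd t ⟨ht.1, ht.2.le⟩).hasDerivWithinAt) 1 (by simp)
  simp only [h] at hk
  have h1 : p + (1 : ℝ) • v = ξ := by rw [hv, one_smul]; abel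
  rw [h1] at hk
  simp at hk
  rw [hk]; ring

lemma conclusion (hΩ : IsOpen Ω) (hc : Convex ℝ Ω) (hne : Ω.Nonempty)
    (hu : ContDiffOn ℝ (⊤ : ℕ∞) u Ω)
    (h3 : ∀ x ∈ Ω, ∀ e, DD e (DD e (DD e u)) x = 0)
    (hproper : ∀ C : ℝ, IsCompact {ξ ∈ Ω | u ξ ≤ C}) :
    Ω = Set.univ ∧ ∃ (Q : Matrix (Fin n) (Fin n) ℝ) (b : Fin n → ℝ) (c : ℝ), ∀ ξ ∈ Ω,
      u ξ = (∑ i, ∑ j, Q i j * ξ i * ξ j) + (∑ i, b i * ξ i) + c := by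
  obtain ⟨p, hp⟩ := hne
  let H := hess u p
  let g : Fin n → ℝ := fun i => pd i u p
  let F : (Fin n → ℝ) → ℝ := fun ξ => u p + (∑ i, (ξ i - p i) * g i) +
    1 / 2 * ∑ i, ∑ j, (ξ i - p i) * (H i j * (ξ j - p j))
  have hF : ∀ ξ ∈ Ω, u ξ = F ξ := by
    intro ξ hξ
    rw [taylor_third_zero hΩ hc hu h3 hp hξ, DD_eq_pd, DD_hess hΩ hu _ _ hp]
    simp only [F, g, H, dotProduct, Matrix.mulVec, Pi.sub_apply, Finset.mul_sum]
  have hFc : Continuous F := by fun_prop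
  refine ⟨?_, Matrix.of fun i j => 1 / 2 * H i j,
    fun i => g i - 1 / 2 * ∑ j, (H i j * p j + H j i * p j),
    u p - ∑ i, p i * g i + 1 / 2 * ∑ i, ∑ j, p i * (H i j * p j), ?_⟩
  · have hcl : IsClosed Ω := by
      rw [← closure_subset_iff_isClosed]
      intro q hq
      have hS : IsClosed {ξ ∈ Ω | u ξ ≤ F q + 1} := (hproper _).isClosed
      have hO : IsOpen {ξ | F ξ < F q + 1} := isOpen_lt hFc continuous_const
      have : q ∈ closure {ξ ∈ Ω | u ξ ≤ F q + 1} := by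
        have h1 := hO.inter_closure (t := Ω) ⟨(by simp : q ∈ {ξ | F ξ < F q + 1}), hq⟩
        refine closure_mono ?_ h1
        rintro ξ ⟨h2, h3⟩
        refine ⟨h3, ?_⟩
        rw [hF ξ h3]
        exact le_of_lt h2
      exact (hS.closure_eq ▸ this : q ∈ {ξ ∈ Ω | u ξ ≤ F q + 1}).1
    exact IsClopen.eq_univ ⟨hcl, hΩ⟩ ⟨p, hp⟩
  · intro ξ hξ
    rw [hF ξ hξ]
    simp only [F, Matrix.of_apply]
    have e1 : ∑ i, (ξ i - p i) * g i = ∑ i, g i * ξ i - ∑ i, p i * g i := by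
      rw [← Finset.sum_sub_distrib]; exact Finset.sum_congr rfl fun i _ => by ring
    have e2 : ∑ i, ∑ j, (ξ i - p i) * (H i j * (ξ j - p j)) =
        ∑ i, ∑ j, ξ i * (H i j * ξ j) - ∑ i, ∑ j, (H i j * p j) * ξ i
          - ∑ i, ∑ j, (H i j * p i) * ξ j + ∑ i, ∑ j, p i * (H i j * p j) := by
      simp only [← Finset.sum_sub_distrib, ← Finset.sum_add_distrib]
      exact Finset.sum_congr rfl fun i _ => Finset.sum_congr rfl fun j _ => by ring
    have e3 : ∑ i, ∑ j, (H i j * p i) * ξ j = ∑ i, ∑ j, (H j i * p j) * ξ i := Finset.sum_comm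
    have e4 : ∑ i, (g i - 1 / 2 * ∑ j, (H i j * p j + H j i * p j)) * ξ i =
        ∑ i, g i * ξ i - 1 / 2 * ∑ i, ∑ j, (H i j * p j) * ξ i
          - 1 / 2 * ∑ i, ∑ j, (H j i * p j) * ξ i := by
      simp only [Finset.mul_sum, ← Finset.sum_sub_distrib]
      refine Finset.sum_congr rfl fun i _ => ?_
      rw [sub_mul, Finset.sum_mul, sub_sub, ← Finset.sum_add_distrib]
      congr 1
      exact Finset.sum_congr rfl fun j _ => by ring
    have e5 : ∑ i, ∑ j, 1 / 2 * H i j * ξ i * ξ j = 1 / 2 * ∑ i, ∑ j, ξ i * (H i j * ξ j) := by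
      simp only [Finset.mul_sum]
      exact Finset.sum_congr rfl fun i _ => Finset.sum_congr rfl fun j _ => by ring
    rw [e1, e2, e3, e4, e5]
    ring
end concl

lemma mat_ineq {n : ℕ} (A : Fin n → Fin n → ℝ) (hA : ∀ a b, A a b = A b a) (i0 : Fin n) :
    (∑ a, A a a - A i0 i0) ^ 2 ≤ ((n : ℝ) - 1) *
      (∑ a, ∑ b, A a b ^ 2 - ∑ a, A a i0 ^ 2 - ∑ a ∈ Finset.univ.erase i0, A a i0 ^ 2) := by
  set s : Finset (Fin n) := Finset.univ.erase i0 with hs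
  have hsplit : ∀ f : Fin n → ℝ, ∑ a, f a = f i0 + ∑ a ∈ s, f a := fun f =>
    (Finset.add_sum_erase _ f (Finset.mem_univ i0)).symm
  have h1 : ∑ a, A a a - A i0 i0 = ∑ a ∈ s, A a a := by rw [hsplit]; ring
  have hcard : ((s.card : ℕ) : ℝ) = (n : ℝ) - 1 := by
    rw [hs, Finset.card_erase_of_mem (Finset.mem_univ _), Finset.card_univ, Fintype.card_fin,
      Nat.cast_sub (by have := i0.2; omega)]
    simp
  have h2 : (∑ a ∈ s, A a a) ^ 2 ≤ ((n : ℝ) - 1) * ∑ a ∈ s, A a a ^ 2 := by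
    rw [← hcard]; exact sq_sum_le_card_mul_sum_sq
  have h3 : ∑ a ∈ s, A a a ^ 2 ≤ ∑ a ∈ s, ∑ b ∈ s, A a b ^ 2 :=
    Finset.sum_le_sum fun a ha =>
      Finset.single_le_sum (f := fun b => A a b ^ 2) (fun b _ => sq_nonneg _) ha
  have h4 : ∑ a, ∑ b, A a b ^ 2 - ∑ a, A a i0 ^ 2 - ∑ a ∈ s, A a i0 ^ 2
      = ∑ a ∈ s, ∑ b ∈ s, A a b ^ 2 := by
    rw [← Finset.sum_sub_distrib]
    have : ∀ a, ∑ b, A a b ^ 2 - A a i0 ^ 2 = ∑ b ∈ s, A a b ^ 2 := by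
      intro a; rw [hsplit]; ring
    simp only [this]
    rw [hsplit (fun a => ∑ b ∈ s, A a b ^ 2)]
    have h5 : ∑ b ∈ s, A i0 b ^ 2 = ∑ a ∈ s, A a i0 ^ 2 :=
      Finset.sum_congr rfl fun a _ => by rw [hA]
    rw [h5]; ring
  rw [h1, h4]
  have hn : (0 : ℝ) ≤ (n : ℝ) - 1 := by rw [← hcard]; positivity
  exact h2.trans (mul_le_mul_of_nonneg_left h3 hn)

lemma scalarI {N θ σ : ℝ} (hN : 1 ≤ N) (h0 : 0 ≤ σ) (h1 : σ ≤ 1)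
    (hs : (0 ≤ θ ∧ 1 / 2 ≤ σ) ∨ (θ ≤ 0 ∧ σ ≤ 1 / 2)) :
    1 / (16 * N) ≤ (1 + θ + N * σ) ^ 2 / N - θ - θ ^ 2 / (4 * (N + 1))
      - 1 / (4 * N) * (σ * (1 - σ)) := by
  have hN0 : 0 < N := by linarith
  have e1 : 1 / (4 * N) * (σ * (1 - σ)) ≤ 1 / (16 * N) := by
    have : σ * (1 - σ) ≤ 1 / 4 := by nlinarith [sq_nonneg (σ - 1 / 2)]
    calc 1 / (4 * N) * (σ * (1 - σ)) ≤ 1 / (4 * N) * (1 / 4) := by gcongr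
      _ = 1 / (16 * N) := by field_simp; norm_num
  have e2 : 1 / (16 * N) ≤ 1 / 16 := by
    apply one_div_le_one_div_of_le <;> linarith
  suffices h : 2 * (1 / (16 * N)) ≤ (1 + θ + N * σ) ^ 2 / N - θ - θ ^ 2 / (4 * (N + 1)) by linarith
  have e3 : 1 / (16 * N) = (1 / 16) / N := by field_simp
  rcases hs with ⟨ht, hσ⟩ | ⟨ht, hσ⟩
  · have w : (θ + (1 + N / 2)) ^ 2 ≤ (1 + θ + N * σ) ^ 2 := by
      apply pow_le_pow_left₀ (by positivity)
      nlinarith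
    have w2 : (θ + (1 + N / 2)) ^ 2 / N ≤ (1 + θ + N * σ) ^ 2 / N := by gcongr
    have w3 : θ ^ 2 / (4 * (N + 1)) ≤ θ ^ 2 / N := by
      apply div_le_div_of_nonneg_left (by positivity) hN0; linarith
    have w4 : (θ + (1 + N / 2)) ^ 2 / N = θ ^ 2 / N + θ + (2 * θ + (1 + N / 2) ^ 2) / N := by
      field_simp; ring
    have w5 : 2 * (1 / (16 * N)) ≤ (2 * θ + (1 + N / 2) ^ 2) / N := by
      rw [e3, ← mul_div_assoc]
      apply div_le_div_of_nonneg_right _ hN0.le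
      nlinarith
    linarith
  · rcases le_total (-θ) (2 + N) with h2 | h2
    · have w3 : θ ^ 2 / (4 * (N + 1)) ≤ -θ / 2 := by
        rw [div_le_iff₀ (by positivity)]
        nlinarith
      rcases le_total (-θ) (1 / 4) with h4 | h4
      · have w : (3 / 4) ^ 2 ≤ (1 + θ + N * σ) ^ 2 := by
          apply pow_le_pow_left₀ (by positivity)
          nlinarith
        have w2 : (3 / 4) ^ 2 / N ≤ (1 + θ + N * σ) ^ 2 / N := by gcongr
        have w5 : 2 * (1 / (16 * N)) ≤ (3 / 4) ^ 2 / N := by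
          rw [e3, ← mul_div_assoc]
          apply div_le_div_of_nonneg_right _ hN0.le
          norm_num
        linarith
      · have : 0 ≤ (1 + θ + N * σ) ^ 2 / N := by positivity
        linarith
    · have w : (θ / 2) ^ 2 ≤ (1 + θ + N * σ) ^ 2 := by
        rw [← neg_sq (θ / 2), ← neg_sq (1 + θ + N * σ)]
        apply pow_le_pow_left₀ (by linarith)
        nlinarith
      have w2 : (θ / 2) ^ 2 / N ≤ (1 + θ + N * σ) ^ 2 / N := by gcongr
      have w3 : θ ^ 2 / (4 * (N + 1)) ≤ (θ / 2) ^ 2 / N := by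
        rw [div_le_div_iff₀ (by positivity) hN0]
        nlinarith [sq_nonneg θ]
      linarith

section stepI
variable {n : ℕ} {Ω : Set (Fin n → ℝ)} {u f : (Fin n → ℝ) → ℝ}

lemma DD2_pos (hΩ : IsOpen Ω) (hu : ContDiffOn ℝ (⊤ : ℕ∞) u Ω)
    (hconv : ∀ x ∈ Ω, (hess u x).PosDef) {x : Fin n → ℝ} (hx : x ∈ Ω) {e : Fin n → ℝ}
    (he : e ≠ 0) : 0 < DD e (DD e u) x := by
  rw [DD_hess hΩ hu _ _ hx]
  simpa using (hconv x hx).dotProduct_mulVec_pos he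

lemma frame (hΩ : IsOpen Ω) (hu : ContDiffOn ℝ (⊤ : ℕ∞) u Ω)
    (hconv : ∀ x ∈ Ω, (hess u x).PosDef) {x : Fin n → ℝ} (hx : x ∈ Ω) {e : Fin n → ℝ}
    (he : DD e (DD e u) x = 1) (i0 : Fin n) :
    ∃ V : Fin n → (Fin n → ℝ), V i0 = e ∧
      ∀ a b, DD (V a) (DD (V b) u) x = if a = b then 1 else 0 := by
  rw [DD_hess hΩ hu _ _ hx] at he
  obtain ⟨V, h1, h2⟩ := exists_frame (hconv x hx) e he i0
  exact ⟨V, h1, fun a b => by rw [DD_hess hΩ hu _ _ hx, h2]⟩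

lemma jet_eta (hΩ : IsOpen Ω) (hu : ContDiffOn ℝ (⊤ : ℕ∞) u Ω) {x : Fin n → ℝ} (hx : x ∈ Ω)
    (v : Fin n → ℝ) {R : ℝ} (hR : u x < R) :
    Jet2 (fun t => Real.log (R - u (x + t • v))) (Real.log (R - u x)) (-(DD v u x / (R - u x)))
      (-(DD v (DD v u) x / (R - u x)) - (DD v u x / (R - u x)) ^ 2) := by
  have h := ((Jet2.const R).add ((jet_line hΩ hu hx v).const_mul (-1))).cast
    (a' := R - u x) (b' := - DD v u x) (c' := - DD v (DD v u) x) (by ring) (by ring) (by ring)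
  refine ((h.log (sub_pos.2 hR)).cast rfl (by ring) (by ring)).congr
    (Eventually.of_forall fun t => ?_)
  congr 1; ring

lemma eta_ev (hΩ : IsOpen Ω) (hu : ContDiffOn ℝ (⊤ : ℕ∞) u Ω) {x : Fin n → ℝ} (hx : x ∈ Ω)
    (v : Fin n → ℝ) {R : ℝ} (hR : u x < R) :
    ∀ᶠ t in 𝓝 (0 : ℝ), x + t • v ∈ Ω ∧ u (x + t • v) < R := by
  have hc : ContinuousAt (fun t : ℝ => u (x + t • v)) 0 :=
    (DD_line hΩ hu x v 0 (by simpa using hx)).continuousAt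
  exact (line_ev hΩ hx v).and (hc.eventually_lt_const (by simpa using hR))

lemma stepI_pt (hΩ : IsOpen Ω) (hu : ContDiffOn ℝ (⊤ : ℕ∞) u Ω)
    {x : Fin n → ℝ} (hx : x ∈ Ω) {e : Fin n → ℝ} (V : Fin n → (Fin n → ℝ)) (i0 : Fin n)
    (hVe : V i0 = e) (hV : ∀ a b, DD (V a) (DD (V b) u) x = if a = b then 1 else 0)
    {R : ℝ} (hR : u x < R) (m q : ℝ) (h h1 : ℝ → ℝ) (h2 : ℝ)
    (hh : ∀ s, HasDerivAt h (h1 s) s) (hh1 : HasDerivAt h1 h2 (q * DD e u x))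
    (hmax : ∀ y ∈ Ω, u y < R → Real.log (DD e (DD e u) y) + m * Real.log (R - u y) +
      h (q * DD e u y) ≤ Real.log (DD e (DD e u) x) + m * Real.log (R - u x) + h (q * DD e u x))
    (a : Fin n) :
    (DD (V a) (DD (V i0) (DD e u)) x = m / (R - u x) * DD (V a) u x
      - h1 (q * DD e u x) * q * (if a = i0 then 1 else 0)) ∧
    DD (V a) (DD (V a) (DD e (DD e u))) x - DD (V a) (DD (V i0) (DD e u)) x ^ 2
      - m / (R - u x) - m / (R - u x) ^ 2 * DD (V a) u x ^ 2
      + h2 * q ^ 2 * (if a = i0 then 1 else 0)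
      + h1 (q * DD e u x) * q * DD (V a) (DD (V a) (DD e u)) x ≤ 0 := by
  have hee : DD e (DD e u) x = 1 := by rw [← hVe, hV]; simp
  have j1 := (jet_line hΩ (DD_smooth hΩ (DD_smooth hΩ hu e) e) hx (V a)).log (by rw [hee]; norm_num)
  have j2 := (jet_eta hΩ hu hx (V a) hR).const_mul m
  have j3 := ((jet_line hΩ (DD_smooth hΩ hu e) hx (V a)).const_mul q).comp (φ := h) (φ1 := h1)
    (Eventually.of_forall hh) hh1
  have hm : IsLocalMax (fun t : ℝ => Real.log (DD e (DD e u) (x + t • V a)) +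
      m * Real.log (R - u (x + t • V a)) + h (q * DD e u (x + t • V a))) 0 := by
    filter_upwards [eta_ev hΩ hu hx (V a) hR] with t ht
    simpa using hmax _ ht.1 ht.2
  obtain ⟨r1, r2⟩ := ((j1.add j2).add j3).localMax hm
  have hae : DD (V a) (DD e u) x = if a = i0 then 1 else 0 := by rw [← hVe, hV]
  have haa : DD (V a) (DD (V a) u) x = 1 := by rw [hV]; simp
  rw [hee, hae] at r1 r2
  rw [haa] at r2
  have hη : R - u x ≠ 0 := (sub_pos.2 hR).ne'
  have hsq : (if a = i0 then (1 : ℝ) else 0) ^ 2 = if a = i0 then 1 else 0 := by split_ifs <;> simp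
  rw [hVe]
  constructor
  · rw [div_one] at r1
    have : m * -(DD (V a) u x / (R - u x)) = - (m / (R - u x) * DD (V a) u x) := by ring
    rw [this] at r1
    linarith
  · rw [div_one, div_one, mul_pow, hsq] at r2
    refine le_trans (le_of_eq ?_) r2
    field_simp
    ring

lemma stepI_ineq (hn : 2 ≤ n) (hΩ : IsOpen Ω) (hu : ContDiffOn ℝ (⊤ : ℕ∞) u Ω)
    (hconv : ∀ x ∈ Ω, (hess u x).PosDef) (d : Fin n → ℝ) (d0 : ℝ)
    (hpde : ∀ ξ ∈ Ω, (hess u ξ).det = Real.exp (-(∑ i : Fin n, d i * pd i u ξ) - d0))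
    {x : Fin n → ℝ} (hx : x ∈ Ω) {e : Fin n → ℝ} (he : DD e (DD e u) x = 1)
    {R : ℝ} (hR : u x < R) (m q : ℝ) (hm1 : 1 ≤ m) (hd : d = q • e) (h h1 : ℝ → ℝ) (h2 : ℝ)
    (hh : ∀ s, HasDerivAt h (h1 s) s) (hh1 : HasDerivAt h1 h2 (q * DD e u x))
    (hmax : ∀ y ∈ Ω, u y < R → Real.log (DD e (DD e u) y) + m * Real.log (R - u y) +
      h (q * DD e u y) ≤ Real.log (DD e (DD e u) x) + m * Real.log (R - u x) + h (q * DD e u x)) :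
    (q + m / (R - u x) * DD e u x - h1 (q * DD e u x) * q) ^ 2 ≤ ((n : ℝ) - 1) *
      (m / (R - u x) * q * DD e u x + m / (R - u x) * n + (m / (R - u x) * DD e u x) ^ 2 / m
        - h2 * q ^ 2) := by
  set i0 : Fin n := ⟨0, by omega⟩
  obtain ⟨V, hVe, hV⟩ := frame hΩ hu hconv hx he i0
  have key := stepI_pt hΩ hu hx V i0 hVe hV hR m q h h1 h2 hh hh1 hmax
  obtain ⟨p1, p2, -⟩ := pde_frame hΩ hu d d0 hpde hx V hV e
  have hη : 0 < R - u x := sub_pos.2 hR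
  set κ := m / (R - u x) with hκ
  set H := h1 (q * DD e u x) with hH
  set A : Fin n → Fin n → ℝ := fun a b => DD (V a) (DD (V b) (DD e u)) x with hA
  have hAs : ∀ a b, A a b = A b a := fun a b => DD_comm hΩ (DD_smooth hΩ hu e) _ _ hx
  have mi := mat_ineq A hAs i0
  have htr : ∑ a, A a a = -q := by
    simp only [hA]
    rw [p1, hd, DD_smul_vec, he, mul_one]
  have hde : DD d (DD e (DD e u)) x = q * A i0 i0 := by
    simp only [hA]; rw [hd, DD_smul_vec, hVe]
  have hsum := Finset.sum_nonpos (s := Finset.univ) fun a _ => (key a).2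
  simp only [Finset.sum_sub_distrib, Finset.sum_add_distrib, ← Finset.mul_sum] at hsum
  simp only [Finset.sum_ite_eq', Finset.mem_univ, if_true, Finset.sum_const, Finset.card_univ,
    Fintype.card_fin, nsmul_eq_mul] at hsum
  rw [hde] at p2
  have hsplit : ∀ f : Fin n → ℝ, ∑ a, f a = f i0 + ∑ a ∈ Finset.univ.erase i0, f a := fun f =>
    (Finset.add_sum_erase _ f (Finset.mem_univ i0)).symm
  have k0 : A i0 i0 = κ * DD e u x - H * q := by
    have := (key i0).1
    rw [hVe] at this
    simpa [hA, hVe] using this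
  have ka : ∑ a ∈ Finset.univ.erase i0, A a i0 ^ 2 =
      κ ^ 2 * ∑ a ∈ Finset.univ.erase i0, DD (V a) u x ^ 2 := by
    rw [Finset.mul_sum]
    refine Finset.sum_congr rfl fun a ha => ?_
    have h3 := (key a).1
    rw [if_neg (Finset.ne_of_mem_erase ha)] at h3
    simp only [hA]
    rw [h3]; ring
  rw [hsplit (fun a => DD (V a) u x ^ 2), hVe] at hsum
  set P' := ∑ a ∈ Finset.univ.erase i0, DD (V a) u x ^ 2
  have hP' : 0 ≤ P' := Finset.sum_nonneg fun a _ => sq_nonneg _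
  have hκm : m / (R - u x) ^ 2 = κ ^ 2 / m := by rw [hκ]; field_simp
  have hn1 : (0 : ℝ) ≤ (n : ℝ) - 1 := by
    have : (2 : ℝ) ≤ n := by exact_mod_cast hn
    linarith
  have hPm : κ ^ 2 / m * P' ≤ κ ^ 2 * P' := by
    apply mul_le_mul_of_nonneg_right _ hP'
    exact div_le_self (sq_nonneg _) hm1
  rw [htr, ka, k0] at mi
  calc _ = (-q - (κ * DD e u x - H * q)) ^ 2 := by ring
    _ ≤ _ := mi
    _ ≤ _ := by
      apply mul_le_mul_of_nonneg_left _ hn1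
      rw [hκm] at hsum
      have e1 : (κ * DD e u x) ^ 2 / m = κ ^ 2 / m * DD e u x ^ 2 := by ring
      rw [e1]
      have htr' : ∑ a, DD (V a) (DD (V a) (DD e u)) x = -q := htr
      rw [htr'] at hsum
      rw [k0] at p2
      simp only [hA, hVe] at p2 ⊢
      nlinarith

end stepI

section stepIfinal
variable {n : ℕ} {Ω : Set (Fin n → ℝ)} {u f : (Fin n → ℝ) → ℝ}

lemma DD2_smul (hΩ : IsOpen Ω) (hu : ContDiffOn ℝ (⊤ : ℕ∞) u Ω) {x : Fin n → ℝ} (hx : x ∈ Ω)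
    (e : Fin n → ℝ) (r : ℝ) : DD (r • e) (DD (r • e) u) x = r ^ 2 * DD e (DD e u) x := by
  have h : DD (r • e) u = fun y => r * DD e u y := by
    funext y; rw [DD_smul_vec]
  rw [DD_smul_vec, h, DD_const_mul hΩ (DD_smooth hΩ hu e) r e hx]
  ring

lemma DD3_smul (hΩ : IsOpen Ω) (hu : ContDiffOn ℝ (⊤ : ℕ∞) u Ω) {x : Fin n → ℝ} (hx : x ∈ Ω)
    (e : Fin n → ℝ) (r : ℝ) : DD (r • e) (DD (r • e) (DD (r • e) u)) x =
      r ^ 3 * DD e (DD e (DD e u)) x := by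
  have h := DD3_expand hΩ hu hx 0 e r
  rw [zero_add] at h
  rw [h]
  have z : ∀ f : (Fin n → ℝ) → ℝ, DD (0 : Fin n → ℝ) f = fun _ => 0 := by
    intro f; funext y; exact DD_zero_vec f y
  have z2 : ∀ v : Fin n → ℝ, DD v (fun _ => (0 : ℝ)) = fun _ => 0 := by
    intro v; funext y; simp [DD]
  simp only [z, z2]
  ring

lemma exists_min (hne : Ω.Nonempty) (hu : ContDiffOn ℝ (⊤ : ℕ∞) u Ω)
    (hproper : ∀ C : ℝ, IsCompact {ξ ∈ Ω | u ξ ≤ C}) : ∃ p ∈ Ω, ∀ y ∈ Ω, u p ≤ u y := by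
  obtain ⟨z, hz⟩ := hne
  obtain ⟨p, hp, hmin⟩ := (hproper (u z)).exists_isMinOn ⟨z, hz, le_rfl⟩
    (hu.continuousOn.mono fun y hy => hy.1)
  refine ⟨p, hp.1, fun y hy => ?_⟩
  rcases le_total (u y) (u z) with h | h
  · exact hmin ⟨hy, h⟩
  · exact hp.2.trans h

lemma stepI_bound (hn : 2 ≤ n) (hΩ : IsOpen Ω) (hu : ContDiffOn ℝ (⊤ : ℕ∞) u Ω)
    (hconv : ∀ x ∈ Ω, (hess u x).PosDef) (d : Fin n → ℝ) (d0 : ℝ)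
    (hpde : ∀ ξ ∈ Ω, (hess u ξ).det = Real.exp (-(∑ i : Fin n, d i * pd i u ξ) - d0))
    (hproper : ∀ C : ℝ, IsCompact {ξ ∈ Ω | u ξ ≤ C}) (hd : d ≠ 0)
    {p : Fin n → ℝ} (hp : p ∈ Ω) (hmin : ∀ y ∈ Ω, u p ≤ u y) :
    ∃ c > 0, ∃ C, ∀ R, u p < R → c * (R - u p) ≤ C := by
  have hn2 : (2 : ℝ) ≤ n := by exact_mod_cast hn
  obtain ⟨N, hN⟩ : ∃ N : ℝ, N = (n : ℝ) - 1 := ⟨_, rfl⟩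
  have hN1 : 1 ≤ N := by linarith
  have hN0 : 0 < N := by linarith
  obtain ⟨α, hα⟩ : ∃ α : ℝ, α = 1 / (4 * N ^ 2) := ⟨_, rfl⟩
  have hα0 : 0 < α := by rw [hα]; positivity
  let σ : ℝ → ℝ := fun s => Real.exp (α * s) / (1 + Real.exp (α * s))
  let h : ℝ → ℝ := fun s => -(N / α) * Real.log (1 + Real.exp (α * s))
  have hE : ∀ s, HasDerivAt (fun s => Real.exp (α * s)) (Real.exp (α * s) * α) s := by
    intro s
    have := ((hasDerivAt_id s).const_mul α).exp
    simpa using this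
  have hpos : ∀ s, 0 < 1 + Real.exp (α * s) := fun s => by positivity
  have hσ : ∀ s, HasDerivAt σ (α * (σ s * (1 - σ s))) s := by
    intro s
    have := (hE s).div ((hE s).const_add 1) (hpos s).ne'
    refine this.congr_deriv ?_
    simp only [σ]
    have := (hpos s).ne'
    field_simp
  have hh : ∀ s, HasDerivAt h (-N * σ s) s := by
    intro s
    have := (((hE s).const_add 1).log (hpos s).ne').const_mul (-(N / α))
    refine this.congr_deriv ?_
    simp only [σ]
    field_simp
  have hle : ∀ s, h s ≤ 0 := by
    intro s
    simp only [h]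
    have : 0 ≤ Real.log (1 + Real.exp (α * s)) := Real.log_nonneg (by linarith [Real.exp_pos (α * s)])
    have h3 : 0 ≤ N / α := by positivity
    nlinarith
  have hσ0 : ∀ s, 0 ≤ σ s := fun s => by positivity
  have hσ1 : ∀ s, σ s ≤ 1 := fun s => by
    simp only [σ]; rw [div_le_one (hpos s)]; linarith
  have hhc : Continuous h := continuous_iff_continuousAt.2 fun s => (hh s).continuousAt
  let Φ : (Fin n → ℝ) → ℝ := DD d (DD d u)
  have hΦ : ∀ y ∈ Ω, 0 < Φ y := fun y hy => DD2_pos hΩ hu hconv hy hd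
  have hΦs := DD_smooth hΩ (DD_smooth hΩ hu d) d
  refine ⟨Φ p * Real.exp (h (DD d u p)), mul_pos (hΦ p hp) (Real.exp_pos _), 64 * N * n ^ 2, ?_⟩
  intro R hR
  let Ψ : (Fin n → ℝ) → ℝ := fun y => Φ y * (R - u y) ^ (4 * n) * Real.exp (h (DD d u y))
  have hΨc : ContinuousOn Ψ {ξ ∈ Ω | u ξ ≤ R} := by
    have s1 := hΦs.continuousOn.mono (fun y (hy : y ∈ {ξ ∈ Ω | u ξ ≤ R}) => hy.1)
    have s2 := hu.continuousOn.mono (fun y (hy : y ∈ {ξ ∈ Ω | u ξ ≤ R}) => hy.1)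
    have s3 := (DD_smooth hΩ hu d).continuousOn.mono
      (fun y (hy : y ∈ {ξ ∈ Ω | u ξ ≤ R}) => hy.1)
    exact (s1.mul ((continuousOn_const.sub s2).pow _)).mul
      (Real.continuous_exp.comp_continuousOn (hhc.comp_continuousOn s3))
  obtain ⟨x, hxK, hmax⟩ := (hproper R).exists_isMaxOn ⟨p, hp, hR.le⟩ hΨc
  have hx : x ∈ Ω := hxK.1
  have hΨp : 0 < Ψ p := mul_pos (mul_pos (hΦ p hp) (pow_pos (sub_pos.2 hR) _)) (Real.exp_pos _)
  have hpx : Ψ p ≤ Ψ x := hmax ⟨hp, hR.le⟩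
  have hxR : u x < R := by
    rcases hxK.2.lt_or_eq with h4 | h4
    · exact h4
    · exfalso
      have : Ψ x = 0 := by
        simp only [Ψ]
        rw [h4, sub_self, zero_pow (by omega)]; simp
      linarith
  have hη : 0 < R - u x := sub_pos.2 hxR
  obtain ⟨q, hq⟩ : ∃ q : ℝ, q = Real.sqrt (Φ x) := ⟨_, rfl⟩
  have hq0 : 0 < q := by rw [hq]; exact Real.sqrt_pos.2 (hΦ x hx)
  have hq2 : q ^ 2 = Φ x := by rw [hq]; exact Real.sq_sqrt (hΦ x hx).le
  obtain ⟨e, he⟩ : ∃ e : Fin n → ℝ, e = q⁻¹ • d := ⟨_, rfl⟩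
  have hde : d = q • e := by rw [he, smul_smul, mul_inv_cancel₀ hq0.ne', one_smul]
  have hee : ∀ y ∈ Ω, Φ y = q ^ 2 * DD e (DD e u) y := by
    intro y hy
    simp only [Φ]
    rw [hde, DD2_smul hΩ hu hy]
  have he1 : DD e (DD e u) x = 1 := by
    have := hee x hx
    rw [← hq2] at this
    have h5 : q ^ 2 ≠ 0 := by positivity
    exact (mul_left_cancel₀ h5 (by rw [mul_one]; exact this)).symm
  have hτ : ∀ y, DD d u y = q * DD e u y := by
    intro y; conv_lhs => rw [hde, DD_smul_vec]
  have hlog : ∀ y ∈ Ω, u y < R → Real.log (Ψ y) = Real.log (q ^ 2) + (Real.log (DD e (DD e u) y) +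
      (4 * n : ℝ) * Real.log (R - u y) + h (q * DD e u y)) := by
    intro y hy hyR
    have hpy := hΦ y hy
    have h6 : 0 < DD e (DD e u) y := by
      have := hee y hy
      rw [this] at hpy
      exact pos_of_mul_pos_right hpy (by positivity)
    have h7 : 0 < (R - u y) ^ (4 * n) := pow_pos (sub_pos.2 hyR) _
    simp only [Ψ]
    rw [Real.log_mul (mul_pos hpy h7).ne' (Real.exp_pos _).ne', Real.log_mul hpy.ne' h7.ne',
      Real.log_exp, Real.log_pow, hee y hy, Real.log_mul (by positivity) h6.ne', hτ]
    push_cast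
    ring
  have hmax' : ∀ y ∈ Ω, u y < R → Real.log (DD e (DD e u) y) + (4 * n : ℝ) * Real.log (R - u y) +
      h (q * DD e u y) ≤ Real.log (DD e (DD e u) x) + (4 * n : ℝ) * Real.log (R - u x)
        + h (q * DD e u x) := by
    intro y hy hyR
    have h8 : Ψ y ≤ Ψ x := hmax ⟨hy, hyR.le⟩
    have h9 : 0 < Ψ y := mul_pos (mul_pos (hΦ y hy) (pow_pos (sub_pos.2 hyR) _)) (Real.exp_pos _)
    have := Real.log_le_log h9 h8
    rw [hlog y hy hyR, hlog x hx hxR] at this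
    linarith
  have key := stepI_ineq hn hΩ hu hconv d d0 hpde hx he1 hxR (4 * n) q (by linarith) hde h
    (fun s => -N * σ s) (-N * (α * (σ (q * DD e u x) * (1 - σ (q * DD e u x))))) hh
    ((hσ _).const_mul (-N)) hmax'
  obtain ⟨η, hηd⟩ : ∃ η : ℝ, η = R - u x := ⟨_, rfl⟩
  obtain ⟨θ, hθ⟩ : ∃ θ : ℝ, θ = 4 * n / (R - u x) * DD e u x / q := ⟨_, rfl⟩
  have hθ' : 4 * n / (R - u x) * DD e u x = θ * q := by rw [hθ]; field_simp
  have hθs : (0 ≤ θ ∧ 1 / 2 ≤ σ (q * DD e u x)) ∨ (θ ≤ 0 ∧ σ (q * DD e u x) ≤ 1 / 2) := by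
    have hk : 0 < 4 * (n : ℝ) / (R - u x) / q := by positivity
    have hθ2 : θ = 4 * (n : ℝ) / (R - u x) / q * DD e u x := by rw [hθ]; ring
    rcases le_total 0 (DD e u x) with h10 | h10
    · left
      refine ⟨by rw [hθ2]; positivity, ?_⟩
      have h11 : 1 ≤ Real.exp (α * (q * DD e u x)) := Real.one_le_exp (by positivity)
      simp only [σ]
      rw [div_le_div_iff₀ (by norm_num) (hpos _)]
      linarith
    · right
      refine ⟨by rw [hθ2]; exact mul_nonpos_of_nonneg_of_nonpos hk.le h10, ?_⟩
      have h11 : Real.exp (α * (q * DD e u x)) ≤ 1 := Real.exp_le_one_iff.2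
        (mul_nonpos_of_nonneg_of_nonpos hα0.le (mul_nonpos_of_nonneg_of_nonpos hq0.le h10))
      simp only [σ]
      rw [div_le_div_iff₀ (hpos _) (by norm_num)]
      linarith
  have sc := scalarI hN1 (hσ0 _) (hσ1 _) hθs
  generalize σ (q * DD e u x) = S at key sc
  have hmain : q ^ 2 * (1 / (16 * N)) ≤ 4 * n / (R - u x) * n := by
    have k2 : (q + θ * q + N * S * q) ^ 2 ≤ N * (θ * q ^ 2 + 4 * n / (R - u x) * n
        + (θ * q) ^ 2 / (4 * n) + N * (α * (S * (1 - S))) * q ^ 2) := by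
      have e1 : 4 * n / (R - u x) * q * DD e u x = θ * q ^ 2 := by
        rw [mul_right_comm, hθ']; ring
      rw [hθ', e1] at key
      rw [← hN] at key
      refine (le_of_eq ?_).trans (key.trans (le_of_eq ?_)) <;> ring
    have k3 : (q + θ * q + N * S * q) ^ 2 / N ≤ (θ * q ^ 2 + 4 * n / (R - u x) * n
        + (θ * q) ^ 2 / (4 * n) + N * (α * (S * (1 - S))) * q ^ 2) := by
      rw [div_le_iff₀ hN0]; linarith
    have k4 : N * (α * (S * (1 - S))) = 1 / (4 * N) * (S * (1 - S)) := by
      rw [hα]; field_simp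
    have k5 : (4 * (N + 1)) = 4 * (n : ℝ) := by rw [hN]; ring
    have k6 := mul_le_mul_of_nonneg_left sc (sq_nonneg q)
    rw [k4] at k3
    rw [k5] at k6
    have k7 : q ^ 2 * ((1 + θ + N * S) ^ 2 / N - θ - θ ^ 2 / (4 * n) - 1 / (4 * N) * (S * (1 - S)))
      = (q + θ * q + N * S * q) ^ 2 / N - θ * q ^ 2 - (θ * q) ^ 2 / (4 * n)
        - 1 / (4 * N) * (S * (1 - S)) * q ^ 2 := by ring
    linarith
  have hfin : Φ x * (R - u x) ≤ 64 * N * n ^ 2 := by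
    rw [← hq2]
    have h12 : 4 * (n : ℝ) / (R - u x) * n = (4 * n ^ 2) / (R - u x) := by ring
    rw [h12, mul_one_div, div_le_div_iff₀ (by positivity) hη] at hmain
    linarith
  have hηp : R - u x ≤ R - u p := by linarith [hmin x hx]
  obtain ⟨k, hk⟩ : ∃ k, 4 * n = k + 1 := ⟨4 * n - 1, by omega⟩
  have hΨx : Ψ x ≤ (64 * N * n ^ 2) * (R - u p) ^ k := by
    simp only [Ψ]
    rw [hk, pow_succ]
    have i1 : Real.exp (h (DD d u x)) ≤ 1 := Real.exp_le_one_iff.2 (hle _)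
    have i2 : 0 ≤ Φ x * ((R - u x) ^ k * (R - u x)) := by
      have := hΦ x hx
      positivity
    calc _ ≤ Φ x * ((R - u x) ^ k * (R - u x)) * 1 := by gcongr
      _ = (Φ x * (R - u x)) * (R - u x) ^ k := by ring
      _ ≤ _ := by gcongr
  have hpw : 0 < (R - u p) ^ k := pow_pos (sub_pos.2 hR) _
  have : Ψ p = Φ p * Real.exp (h (DD d u p)) * (R - u p) * (R - u p) ^ k := by
    simp only [Ψ]; rw [hk]; ring
  rw [this] at hpx
  exact le_of_mul_le_mul_right (hpx.trans hΨx) hpw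

lemma d_eq_zero (hn : 2 ≤ n) (hΩ : IsOpen Ω) (hne : Ω.Nonempty) (hu : ContDiffOn ℝ (⊤ : ℕ∞) u Ω)
    (hconv : ∀ x ∈ Ω, (hess u x).PosDef) (d : Fin n → ℝ) (d0 : ℝ)
    (hpde : ∀ ξ ∈ Ω, (hess u ξ).det = Real.exp (-(∑ i : Fin n, d i * pd i u ξ) - d0))
    (hproper : ∀ C : ℝ, IsCompact {ξ ∈ Ω | u ξ ≤ C}) : d = 0 := by
  by_contra hd
  obtain ⟨p, hp, hmin⟩ := exists_min hne hu hproper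
  obtain ⟨c, hc, C, hC⟩ := stepI_bound hn hΩ hu hconv d d0 hpde hproper hd hp hmin
  have h1 := hC (u p + (|C| / c + 1)) (by have : 0 ≤ |C| / c := by positivity
                                          linarith)
  have h2 : c * (u p + (|C| / c + 1) - u p) = |C| + c := by field_simp; ring
  rw [h2] at h1
  linarith [le_abs_self C]

end stepIfinal

section stepIIa
variable {n : ℕ} {Ω : Set (Fin n → ℝ)} {u f : (Fin n → ℝ) → ℝ}

lemma frame_bb (hΩ : IsOpen Ω) (hu : ContDiffOn ℝ (⊤ : ℕ∞) u Ω)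
    {x : Fin n → ℝ} (hx : x ∈ Ω) (V : Fin n → (Fin n → ℝ))
    (hV : ∀ a b, DD (V a) (DD (V b) u) x = if a = b then 1 else 0) (β : Fin n → ℝ) :
    DD (∑ c, β c • V c) (DD (∑ c, β c • V c) u) x = ∑ c, β c ^ 2 := by
  rw [DD_sum_vec2 hΩ hu Finset.univ β V _ hx]
  refine Finset.sum_congr rfl fun c _ => ?_
  rw [DD_sum_vec]
  simp only [hV]
  simp [sq]

lemma jetIIa (hΩ : IsOpen Ω) (hu : ContDiffOn ℝ (⊤ : ℕ∞) u Ω)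
    {x : Fin n → ℝ} (hx : x ∈ Ω) {e : Fin n → ℝ} (hee : DD e (DD e u) x = 1)
    (hr : 0 < DD e u x) {R : ℝ} (hR : u x < R) (m : ℝ)
    (hmax : ∀ y ∈ Ω, u y < R → ∀ e', 0 < DD e' u y → 0 < DD e' (DD e' u) y →
      2 * Real.log (DD e' u y) + m * Real.log (R - u y) + (-1) * Real.log (DD e' (DD e' u) y) ≤
      2 * Real.log (DD e u x) + m * Real.log (R - u x) + (-1) * Real.log (DD e (DD e u) x))
    (b v : Fin n → ℝ) :
    let r := DD e u x
    let N1 := DD v (DD e u) x + DD b u x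
    let N2 := DD v (DD v (DD e u)) x + 2 * DD v (DD b u) x
    let D1 := DD v (DD e (DD e u)) x + 2 * DD b (DD e u) x
    let D2 := DD v (DD v (DD e (DD e u))) x + 4 * DD v (DD b (DD e u)) x + 2 * DD b (DD b u) x
    let κ := m / (R - u x)
    2 * (N1 / r) - κ * DD v u x - D1 = 0 ∧
    2 * (N2 / r - (N1 / r) ^ 2) - κ * DD v (DD v u) x - m * (DD v u x / (R - u x)) ^ 2
      - (D2 - D1 ^ 2) ≤ 0 := by
  intro r N1 N2 D1 D2 κ
  have jN := jet_N1 hΩ hu hx e b v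
  have jD := jet_D hΩ hu hx e b v
  have j := (((jN.log hr).const_mul 2).add ((jet_eta hΩ hu hx v hR).const_mul m)).add
    ((jD.log (by rw [hee]; norm_num)).const_mul (-1))
  have cN : ContinuousAt (fun t : ℝ => DD (e + t • b) u (x + t • v)) 0 := by
    obtain ⟨_, _, h1, _⟩ := jN
    exact h1.self_of_nhds.continuousAt
  have cD : ContinuousAt (fun t : ℝ => DD (e + t • b) (DD (e + t • b) u) (x + t • v)) 0 := by
    obtain ⟨_, _, h1, _⟩ := jD
    exact h1.self_of_nhds.continuousAt
  have hm : IsLocalMax (fun t : ℝ => 2 * Real.log (DD (e + t • b) u (x + t • v)) +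
      m * Real.log (R - u (x + t • v)) +
      (-1) * Real.log (DD (e + t • b) (DD (e + t • b) u) (x + t • v))) 0 := by
    filter_upwards [eta_ev hΩ hu hx v hR, cN.eventually_const_lt (by simpa using hr),
      cD.eventually_const_lt (u := 0) (by simp [hee])] with t ht ht1 ht2
    simpa using hmax _ ht.1 ht.2 _ ht1 ht2
  obtain ⟨r1, r2⟩ := j.localMax hm
  rw [hee] at r1 r2
  simp only [div_one] at r1 r2
  refine ⟨?_, ?_⟩
  · rw [← r1]; simp only [r, N1, D1, κ]; ring
  · refine le_trans (le_of_eq ?_) r2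
    simp only [r, N1, N2, D1, D2, κ]; ring

lemma scalarIIa {ν s : ℝ} (hν : 2 ≤ ν) (hs : 0 < s)
    (h : (s - 2) ^ 2 * ν + (ν - 1) * (2 * ν - s ^ 2 - ν * s - s ^ 2 / (2 * ν)) ≤ 0) :
    s ≤ 4 * ν ^ 2 := by
  have h1 : (s - 2) ^ 2 * ν * (2 * ν) + (ν - 1) * ((2 * ν - s ^ 2 - ν * s) * (2 * ν) - s ^ 2) ≤ 0 := by
    have : (s - 2) ^ 2 * ν * (2 * ν) + (ν - 1) * ((2 * ν - s ^ 2 - ν * s) * (2 * ν) - s ^ 2) =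
      ((s - 2) ^ 2 * ν + (ν - 1) * (2 * ν - s ^ 2 - ν * s - s ^ 2 / (2 * ν))) * (2 * ν) := by
      field_simp
    rw [this]
    exact mul_nonpos_of_nonpos_of_nonneg h (by linarith)
  have h2 : (ν + 1) * s * s ≤ 2 * ν ^ 2 * (ν + 3) * s := by
    nlinarith [sq_nonneg ν, mul_nonneg (sq_nonneg ν) (by linarith : 0 ≤ ν - 1)]
  have h3 := le_of_mul_le_mul_right h2 hs
  have h4 : 2 * ν ^ 2 * (ν + 3) ≤ (ν + 1) * (4 * ν ^ 2) := by nlinarith [sq_nonneg ν]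
  exact le_of_mul_le_mul_left (h3.trans h4) (by linarith)

lemma ptIIa (hn : 2 ≤ n) (hΩ : IsOpen Ω) (hu : ContDiffOn ℝ (⊤ : ℕ∞) u Ω)
    (hconv : ∀ x ∈ Ω, (hess u x).PosDef) (d0 : ℝ)
    (hpde : ∀ ξ ∈ Ω, (hess u ξ).det = Real.exp (-(∑ i : Fin n, (0 : Fin n → ℝ) i * pd i u ξ) - d0))
    {x : Fin n → ℝ} (hx : x ∈ Ω) {e : Fin n → ℝ} (hee : DD e (DD e u) x = 1)
    (hr : 0 < DD e u x) {R : ℝ} (hR : u x < R)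
    (hmax : ∀ y ∈ Ω, u y < R → ∀ e', 0 < DD e' u y → 0 < DD e' (DD e' u) y →
      2 * Real.log (DD e' u y) + (2 * n : ℝ) * Real.log (R - u y)
        + (-1) * Real.log (DD e' (DD e' u) y) ≤
      2 * Real.log (DD e u x) + (2 * n : ℝ) * Real.log (R - u x)
        + (-1) * Real.log (DD e (DD e u) x)) :
    DD e u x ^ 2 ≤ 2 * n * (R - u x) := by
  have hn2 : (2 : ℝ) ≤ n := by exact_mod_cast hn
  have hη : 0 < R - u x := sub_pos.2 hR
  set i0 : Fin n := ⟨0, by omega⟩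
  obtain ⟨V, hVe, hV⟩ := frame hΩ hu hconv hx hee i0
  have J := jetIIa hΩ hu hx hee hr hR (2 * n) hmax
  obtain ⟨p1, p2, -⟩ := pde_frame hΩ hu 0 d0 hpde hx V hV e
  rw [DD_zero_vec, neg_zero] at p1 p2
  have hs1 := DD_smooth hΩ hu e
  have hae : ∀ a, DD (V a) (DD e u) x = if a = i0 then 1 else 0 := by
    intro a; rw [← hVe, hV]
  have hDz : ∀ f : (Fin n → ℝ) → ℝ, DD (0 : Fin n → ℝ) f x = 0 := fun f => DD_zero_vec f x
  obtain ⟨r, hrd⟩ : ∃ r, r = DD e u x := ⟨_, rfl⟩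
  have hr0 : 0 < r := by rw [hrd]; exact hr
  have hua : ∀ a, DD (V a) u x = if a = i0 then r else 0 := by
    intro a
    have := (J (V a) 0).1
    simp only [hDz, hae, ← hrd, zero_add, mul_zero, sub_zero] at this
    have h1 : DD (V a) u x / r = if a = i0 then 1 else 0 := by linarith
    rw [div_eq_iff hr0.ne'] at h1
    rw [h1]; split_ifs <;> simp
  set A : Fin n → Fin n → ℝ := fun a b => DD (V a) (DD (V b) (DD e u)) x with hA
  have hAs : ∀ a b, A a b = A b a := fun a b => DD_comm hΩ hs1 _ _ hx
  have mi := mat_ineq A hAs i0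
  obtain ⟨κ, hκ⟩ : ∃ κ, κ = 2 * (n : ℝ) / (R - u x) := ⟨_, rfl⟩
  have hκ0 : 0 < κ := by rw [hκ]; positivity
  let β : Fin n → Fin n → ℝ := fun a c => (if a = c then r⁻¹ else 0) - A a c
  have hA0 : ∀ a, DD (V a) (DD e (DD e u)) x = A a i0 := by intro a; simp only [hA, hVe]
  have K : ∀ a, 2 * (if a = i0 then r⁻¹ else 0) - A a i0 = κ * (if a = i0 then r else 0) ∧
      2 * (2 / r - A a a) / r - (κ * (if a = i0 then r else 0)) ^ 2 - κ
        - κ ^ 2 / (2 * n) * (if a = i0 then r else 0) ^ 2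
        - (DD (V a) (DD (V a) (DD e (DD e u))) x - 2 * ∑ c, A a c ^ 2 + 2 / r ^ 2) ≤ 0 := by
    intro a
    obtain ⟨J1, J2⟩ := J (∑ c, β a c • V c) (V a)
    have b1 : DD (∑ c, β a c • V c) u x = (if a = i0 then 1 else 0) - r * A a i0 := by
      rw [DD_sum_vec]
      simp only [hua, β]
      simp only [mul_ite, mul_zero, Finset.sum_ite_eq', Finset.mem_univ, if_true]
      split_ifs
      · rw [sub_mul, inv_mul_cancel₀ hr0.ne']; ring
      · ring
    have b2 : DD (V a) (DD (∑ c, β a c • V c) u) x = r⁻¹ - A a a := by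
      rw [DD_sum_vec2 hΩ hu Finset.univ _ V _ hx]
      simp only [hV, β]
      simp
    have b3 : DD (∑ c, β a c • V c) (DD e u) x = (if a = i0 then r⁻¹ else 0) - A a i0 := by
      rw [DD_sum_vec]
      simp only [hae, β]
      simp
    have b4 : DD (V a) (DD (∑ c, β a c • V c) (DD e u)) x = r⁻¹ * A a a - ∑ c, A a c ^ 2 := by
      rw [DD_sum_vec2 hΩ hs1 Finset.univ _ V _ hx]
      have : ∀ c, DD (V a) (DD (V c) (DD e u)) x = A a c := fun c => rfl
      simp only [this, β, sub_mul, Finset.sum_sub_distrib, ite_mul, zero_mul]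
      simp [sq]
    have b5 : DD (∑ c, β a c • V c) (DD (∑ c, β a c • V c) u) x =
        r⁻¹ ^ 2 - 2 * r⁻¹ * A a a + ∑ c, A a c ^ 2 := by
      rw [frame_bb hΩ hu hx V hV]
      have : ∀ c, β a c ^ 2 = (if a = c then r⁻¹ ^ 2 - 2 * r⁻¹ * A a c else 0) + A a c ^ 2 := by
        intro c; simp only [β]; split_ifs <;> ring
      simp only [this, Finset.sum_add_distrib]
      simp
    have b6 : DD (V a) (DD (V a) (DD e u)) x = A a a := rfl
    have b7 : DD (V a) (DD (V a) u) x = 1 := by rw [hV]; simp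
    simp only [b1, b2, b3, b4, b5, b6, b7, hae, hua, hA0, ← hrd, ← hκ] at J1 J2
    have N1 : ((if a = i0 then (1 : ℝ) else 0) + ((if a = i0 then 1 else 0) - r * A a i0)) / r =
        2 * (if a = i0 then r⁻¹ else 0) - A a i0 := by
      split_ifs <;> field_simp <;> ring
    have D1 : A a i0 + 2 * ((if a = i0 then r⁻¹ else 0) - A a i0) =
        2 * (if a = i0 then r⁻¹ else 0) - A a i0 := by ring
    rw [N1, D1] at J1 J2
    have F1 : 2 * (if a = i0 then r⁻¹ else 0) - A a i0 = κ * (if a = i0 then r else 0) := by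
      linarith
    refine ⟨F1, ?_⟩
    rw [F1] at J2
    refine le_trans (le_of_eq ?_) J2
    have hk2 : κ ^ 2 / (2 * n) = 2 * n / (R - u x) ^ 2 := by rw [hκ]; field_simp
    rw [hk2]
    generalize (if a = i0 then r else 0) = ρ
    generalize ∑ c, A a c ^ 2 = S2
    field_simp
    ring
  have hsum := Finset.sum_nonpos (s := Finset.univ) fun a _ => (K a).2
  have hsplit : ∀ f : Fin n → ℝ, ∑ a, f a = f i0 + ∑ a ∈ Finset.univ.erase i0, f a := fun f =>
    (Finset.add_sum_erase _ f (Finset.mem_univ i0)).symm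
  have k0 : A i0 i0 = 2 * r⁻¹ - κ * r := by
    have := (K i0).1
    simp at this
    linarith
  have ka : ∀ a, a ≠ i0 → A a i0 = 0 := by
    intro a ha
    have := (K a).1
    simp [ha] at this
    exact this
  have kz : ∑ a ∈ Finset.univ.erase i0, A a i0 ^ 2 = 0 :=
    Finset.sum_eq_zero fun a ha => by rw [ka a (Finset.ne_of_mem_erase ha)]; norm_num
  have htr : ∑ a, A a a = 0 := p1
  rw [htr, hsplit (fun a => A a i0 ^ 2), kz, k0] at mi
  have hB : ∑ a, DD (V a) (DD (V a) (DD e (DD e u))) x = ∑ a, ∑ b, A a b ^ 2 := by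
    simp only [hA]; linarith
  have q1 : ∑ a, 2 * (2 / r - A a a) / r = 4 * n / r ^ 2 := by
    have : ∀ a, 2 * (2 / r - A a a) / r = 4 / r ^ 2 - 2 / r * A a a := by
      intro a; field_simp; ring
    simp only [this, Finset.sum_sub_distrib, ← Finset.mul_sum, htr]
    simp; ring
  have q2 : ∀ a : Fin n, (κ * (if a = i0 then r else 0)) ^ 2 = if a = i0 then (κ * r) ^ 2 else 0 := by
    intro a; split_ifs <;> simp
  have q3 : ∀ a : Fin n, κ ^ 2 / (2 * n) * (if a = i0 then r else 0) ^ 2 =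
      if a = i0 then κ ^ 2 / (2 * n) * r ^ 2 else 0 := by
    intro a; split_ifs <;> simp
  simp only [q2, q3, Finset.sum_sub_distrib, Finset.sum_add_distrib, ← Finset.mul_sum, q1, hB] at hsum
  simp only [Finset.sum_ite_eq', Finset.mem_univ, if_true, Finset.sum_const, Finset.card_univ,
    Fintype.card_fin, nsmul_eq_mul] at hsum
  obtain ⟨T, hT⟩ : ∃ T, T = ∑ a, ∑ b, A a b ^ 2 := ⟨_, rfl⟩
  rw [← hT] at hsum mi
  obtain ⟨s, hs⟩ : ∃ s, s = κ * r ^ 2 := ⟨_, rfl⟩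
  have hs0 : 0 < s := by rw [hs]; positivity
  have hfin : s ≤ 4 * (n : ℝ) ^ 2 := by
    apply scalarIIa hn2 hs0
    have m1 : (2 - s) ^ 2 ≤ ((n : ℝ) - 1) * (T * r ^ 2 - (2 - s) ^ 2) := by
      have := mul_le_mul_of_nonneg_right mi (sq_nonneg r)
      refine (le_of_eq ?_).trans (this.trans (le_of_eq ?_)) <;> (rw [hs]; field_simp; ring)
    have m2 : T * r ^ 2 + 2 * n - s ^ 2 - n * s - s ^ 2 / (2 * n) ≤ 0 := by
      have := mul_nonpos_of_nonpos_of_nonneg hsum (sq_nonneg r)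
      refine le_trans (le_of_eq ?_) this
      rw [hs]; field_simp; ring
    have m3 : (0 : ℝ) ≤ (n : ℝ) - 1 := by linarith
    have m4 := mul_nonpos_of_nonneg_of_nonpos m3 m2
    nlinarith
  rw [hs, hκ] at hfin
  rw [← hrd]
  rw [div_mul_eq_mul_div, div_le_iff₀ hη] at hfin
  nlinarith

lemma gradIIa_R (hn : 2 ≤ n) (hΩ : IsOpen Ω) (hu : ContDiffOn ℝ (⊤ : ℕ∞) u Ω)
    (hconv : ∀ x ∈ Ω, (hess u x).PosDef) (d0 : ℝ)
    (hpde : ∀ ξ ∈ Ω, (hess u ξ).det = Real.exp (-(∑ i : Fin n, (0 : Fin n → ℝ) i * pd i u ξ) - d0))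
    (hproper : ∀ C : ℝ, IsCompact {ξ ∈ Ω | u ξ ≤ C})
    {p : Fin n → ℝ} (hp : p ∈ Ω) (hmin : ∀ y ∈ Ω, u p ≤ u y) {R : ℝ} (hR : u p < R) :
    ∀ x ∈ Ω, u x ≤ R → ∀ e, (R - u x) ^ (2 * n) * DD e u x ^ 2 ≤
      2 * n * (R - u p) ^ (2 * n + 1) * DD e (DD e u) x := by
  have hKΩ : {ξ ∈ Ω | u ξ ≤ R} ×ˢ (Set.univ : Set (Fin n → ℝ)) ⊆ Ω ×ˢ Set.univ :=
    Set.prod_mono (fun y hy => hy.1) le_rfl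
  obtain ⟨x0, hx0, e1, he1, hmax⟩ := exists_max_quot (n := n) (by omega) (hproper R)
    ⟨p, hp, hR.le⟩ (fun x e => (R - u x) ^ (2 * n) * DD e u x ^ 2) (fun x e => DD e (DD e u) x) 1
    one_ne_zero
    (((continuousOn_const.sub (hu.continuousOn.comp continuousOn_fst fun q hq => hq.1)).pow _ |>.mul
      ((DD_cont hΩ hu).pow 2)).mono hKΩ) ((DD2_cont hΩ hu).mono hKΩ)
    (fun x hx e he => DD2_pos hΩ hu hconv hx.1 he)
    (fun x hx e r => by simp only [DD_smul_vec]; ring)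
    (fun x hx e r => DD2_smul hΩ hu hx.1 e r)
  simp only [pow_one] at hmax
  have hup : 0 < R - u p := sub_pos.2 hR
  have hD0 : ∀ y ∈ Ω, ∀ e, 0 ≤ DD e (DD e u) y := by
    intro y hy e
    by_cases he : e = 0
    · rw [he, DD_zero_vec]
    · exact (DD2_pos hΩ hu hconv hy he).le
  suffices hM : (R - u x0) ^ (2 * n) * DD e1 u x0 ^ 2 ≤ 2 * n * (R - u p) ^ (2 * n + 1) by
    intro x hx hxR e
    exact (hmax x ⟨hx, hxR⟩ e).trans (mul_le_mul_of_nonneg_right hM (hD0 x hx e))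
  have hη0 : 0 ≤ R - u x0 := sub_nonneg.2 hx0.2
  rcases hη0.eq_or_lt with h0 | hη
  · rw [← h0, zero_pow (by omega)]
    simp only [zero_mul]; positivity
  by_cases hr0 : DD e1 u x0 = 0
  · rw [hr0]; simp only [ne_eq, OfNat.ofNat_ne_zero, not_false_eq_true, zero_pow, mul_zero]
    positivity
  obtain ⟨e, hee, hr, hre⟩ : ∃ e, DD e (DD e u) x0 = 1 ∧ 0 < DD e u x0 ∧
      DD e u x0 ^ 2 = DD e1 u x0 ^ 2 := by
    rcases lt_or_gt_of_ne hr0 with h1 | h1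
    · refine ⟨(-1 : ℝ) • e1, ?_, ?_, ?_⟩
      · rw [DD2_smul hΩ hu hx0.1]; simpa using he1
      · rw [DD_smul_vec]; linarith
      · rw [DD_smul_vec]; ring
    · exact ⟨e1, he1, h1, rfl⟩
  have hb := ptIIa hn hΩ hu hconv d0 hpde hx0.1 hee hr (R := R) (by linarith) (by
    intro y hy hyR e' h1 h2
    have h3 := hmax y ⟨hy, hyR.le⟩ e'
    rw [← hre] at h3
    have h4 : 0 < (R - u y) ^ (2 * n) := pow_pos (sub_pos.2 hyR) _
    have h5 : 0 < (R - u x0) ^ (2 * n) := pow_pos hη _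
    have h6 := Real.log_le_log (by positivity) h3
    rw [Real.log_mul h4.ne' (by positivity), Real.log_mul (by positivity) h2.ne',
      Real.log_mul h5.ne' (by positivity), Real.log_pow, Real.log_pow, Real.log_pow,
      Real.log_pow] at h6
    rw [hee, Real.log_one]
    push_cast at h6
    linarith)
  rw [← hre]
  have hηp : R - u x0 ≤ R - u p := by linarith [hmin x0 hx0.1]
  calc _ ≤ (R - u x0) ^ (2 * n) * (2 * n * (R - u x0)) := by gcongr
    _ = 2 * n * (R - u x0) ^ (2 * n + 1) := by ring
    _ ≤ _ := by gcongr

lemma gradIIa (hn : 2 ≤ n) (hΩ : IsOpen Ω) (hu : ContDiffOn ℝ (⊤ : ℕ∞) u Ω)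
    (hconv : ∀ x ∈ Ω, (hess u x).PosDef) (d0 : ℝ)
    (hpde : ∀ ξ ∈ Ω, (hess u ξ).det = Real.exp (-(∑ i : Fin n, (0 : Fin n → ℝ) i * pd i u ξ) - d0))
    (hproper : ∀ C : ℝ, IsCompact {ξ ∈ Ω | u ξ ≤ C})
    {p : Fin n → ℝ} (hp : p ∈ Ω) (hmin : ∀ y ∈ Ω, u p ≤ u y) {ρ : ℝ} (hρ : 0 < ρ) :
    ∀ x ∈ Ω, u x ≤ u p + ρ → ∀ e, DD e u x ^ 2 ≤
      (2 * n * 2 ^ (2 * n + 1)) * ρ * DD e (DD e u) x := by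
  intro x hx hxρ e
  have h1 := gradIIa_R hn hΩ hu hconv d0 hpde hproper hp hmin (R := u p + 2 * ρ) (by linarith)
    x hx (by linarith) e
  have h2 : ρ ^ (2 * n) ≤ (u p + 2 * ρ - u x) ^ (2 * n) :=
    pow_le_pow_left₀ hρ.le (by linarith) _
  have h3 : ρ ^ (2 * n) * DD e u x ^ 2 ≤ ρ ^ (2 * n) *
      ((2 * n * 2 ^ (2 * n + 1)) * ρ * DD e (DD e u) x) := by
    refine (mul_le_mul_of_nonneg_right h2 (sq_nonneg _)).trans (h1.trans (le_of_eq ?_))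
    rw [show u p + 2 * ρ - u p = 2 * ρ by ring, mul_pow]
    ring
  exact le_of_mul_le_mul_left h3 (by positivity)

end stepIIa

section stepIIb
variable {n : ℕ} {Ω : Set (Fin n → ℝ)} {u f : (Fin n → ℝ) → ℝ}

lemma jetIIb (hΩ : IsOpen Ω) (hu : ContDiffOn ℝ (⊤ : ℕ∞) u Ω)
    {x : Fin n → ℝ} (hx : x ∈ Ω) {e : Fin n → ℝ} (hee : DD e (DD e u) x = 1)
    (hr : 0 < DD e (DD e (DD e u)) x) {R : ℝ} (hR : u x < R)
    (hmax : ∀ y ∈ Ω, u y < R → ∀ e', 0 < DD e' (DD e' (DD e' u)) y → 0 < DD e' (DD e' u) y →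
      2 * Real.log (DD e' (DD e' (DD e' u)) y) + 4 * Real.log (R - u y)
        + (-3) * Real.log (DD e' (DD e' u) y) ≤
      2 * Real.log (DD e (DD e (DD e u)) x) + 4 * Real.log (R - u x)
        + (-3) * Real.log (DD e (DD e u) x))
    (b v : Fin n → ℝ) :
    let l := DD e (DD e (DD e u)) x
    let N1 := DD v (DD e (DD e (DD e u))) x + 3 * DD b (DD e (DD e u)) x
    let N2 := DD v (DD v (DD e (DD e (DD e u)))) x + 6 * DD v (DD b (DD e (DD e u))) x
        + 6 * DD b (DD b (DD e u)) x
    let D1 := DD v (DD e (DD e u)) x + 2 * DD b (DD e u) x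
    let D2 := DD v (DD v (DD e (DD e u))) x + 4 * DD v (DD b (DD e u)) x + 2 * DD b (DD b u) x
    let κ := 4 / (R - u x)
    2 * (N1 / l) - κ * DD v u x - 3 * D1 = 0 ∧
    2 * (N2 / l - (N1 / l) ^ 2) - κ * DD v (DD v u) x - 4 * (DD v u x / (R - u x)) ^ 2
      - 3 * (D2 - D1 ^ 2) ≤ 0 := by
  intro l N1 N2 D1 D2 κ
  have jN := jet_N3 hΩ hu hx e b v
  have jD := jet_D hΩ hu hx e b v
  have j := (((jN.log hr).const_mul 2).add ((jet_eta hΩ hu hx v hR).const_mul 4)).add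
    ((jD.log (by rw [hee]; norm_num)).const_mul (-3))
  have cN : ContinuousAt (fun t : ℝ =>
      DD (e + t • b) (DD (e + t • b) (DD (e + t • b) u)) (x + t • v)) 0 := by
    obtain ⟨_, _, h1, _⟩ := jN
    exact h1.self_of_nhds.continuousAt
  have cD : ContinuousAt (fun t : ℝ => DD (e + t • b) (DD (e + t • b) u) (x + t • v)) 0 := by
    obtain ⟨_, _, h1, _⟩ := jD
    exact h1.self_of_nhds.continuousAt
  have hm : IsLocalMax (fun t : ℝ =>
      2 * Real.log (DD (e + t • b) (DD (e + t • b) (DD (e + t • b) u)) (x + t • v)) +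
      4 * Real.log (R - u (x + t • v)) +
      (-3) * Real.log (DD (e + t • b) (DD (e + t • b) u) (x + t • v))) 0 := by
    filter_upwards [eta_ev hΩ hu hx v hR, cN.eventually_const_lt (by simpa using hr),
      cD.eventually_const_lt (u := 0) (by simp [hee])] with t ht ht1 ht2
    simpa using hmax _ ht.1 ht.2 _ ht1 ht2
  obtain ⟨r1, r2⟩ := j.localMax hm
  rw [hee] at r1 r2
  simp only [div_one] at r1 r2
  refine ⟨?_, ?_⟩
  · rw [← r1]; simp only [l, N1, D1, κ]; ring
  · refine le_trans (le_of_eq ?_) r2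
    simp only [l, N1, N2, D1, D2, κ]; ring

lemma ptIIb (hn : 2 ≤ n) (hΩ : IsOpen Ω) (hu : ContDiffOn ℝ (⊤ : ℕ∞) u Ω)
    (hconv : ∀ x ∈ Ω, (hess u x).PosDef) (d0 : ℝ)
    (hpde : ∀ ξ ∈ Ω, (hess u ξ).det = Real.exp (-(∑ i : Fin n, (0 : Fin n → ℝ) i * pd i u ξ) - d0))
    {x : Fin n → ℝ} (hx : x ∈ Ω) {e : Fin n → ℝ} (hee : DD e (DD e u) x = 1)
    (hr : 0 < DD e (DD e (DD e u)) x) {R : ℝ} (hR : u x < R)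
    (hmax : ∀ y ∈ Ω, u y < R → ∀ e', 0 < DD e' (DD e' (DD e' u)) y → 0 < DD e' (DD e' u) y →
      2 * Real.log (DD e' (DD e' (DD e' u)) y) + 4 * Real.log (R - u y)
        + (-3) * Real.log (DD e' (DD e' u) y) ≤
      2 * Real.log (DD e (DD e (DD e u)) x) + 4 * Real.log (R - u x)
        + (-3) * Real.log (DD e (DD e u) x))
    (G : ℝ) (hG : ∀ e, DD e u x ^ 2 ≤ G * DD e (DD e u) x) (hG0 : 0 ≤ G) :
    DD e (DD e (DD e u)) x ^ 2 ≤ 24 * G / (R - u x) ^ 2 + 8 * n / (R - u x) := by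
  have hη : 0 < R - u x := sub_pos.2 hR
  set i0 : Fin n := ⟨0, by omega⟩
  obtain ⟨V, hVe, hV⟩ := frame hΩ hu hconv hx hee i0
  have J := jetIIb hΩ hu hx hee hr hR hmax
  obtain ⟨p1, p2, p3⟩ := pde_frame hΩ hu 0 d0 hpde hx V hV e
  rw [DD_zero_vec, neg_zero] at p1 p2 p3
  have hs1 := DD_smooth hΩ hu e
  have hs2 := DD_smooth hΩ hs1 e
  have hae : ∀ a, DD (V a) (DD e u) x = if a = i0 then 1 else 0 := by
    intro a; rw [← hVe, hV]
  have hDz : ∀ f : (Fin n → ℝ) → ℝ, DD (0 : Fin n → ℝ) f x = 0 := fun f => DD_zero_vec f x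
  obtain ⟨l, hld⟩ : ∃ l, l = DD e (DD e (DD e u)) x := ⟨_, rfl⟩
  have hl0 : 0 < l := by rw [hld]; exact hr
  set A : Fin n → Fin n → ℝ := fun a b => DD (V a) (DD (V b) (DD e u)) x with hA
  have hAs : ∀ a b, A a b = A b a := fun a b => DD_comm hΩ hs1 _ _ hx
  have hA0 : ∀ a, DD (V a) (DD e (DD e u)) x = A a i0 := by intro a; simp only [hA, hVe]
  have hA' : ∀ a b, DD (V a) (DD (V b) (DD e u)) x = A a b := fun a b => rfl
  have hAl : ∀ a, A a i0 = if a = i0 then l else 0 := by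
    intro a
    have := (J (V a) 0).1
    simp only [hDz, hae, hA0, ← hld, zero_add, mul_zero, sub_zero] at this
    have h1 : A a i0 / l = if a = i0 then 1 else 0 := by
      have : 3 * A a i0 / l = 3 * (A a i0 / l) := by ring
      linarith
    rw [div_eq_iff hl0.ne'] at h1
    rw [h1]; split_ifs <;> simp
  have f1 : ∀ β : Fin n → ℝ, DD (∑ c, β c • V c) (DD e (DD e u)) x = β i0 * l := by
    intro β
    rw [DD_sum_vec]
    simp only [hA0, hAl]
    simp
  have f2 : ∀ β : Fin n → ℝ, DD (∑ c, β c • V c) (DD e u) x = β i0 := by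
    intro β
    rw [DD_sum_vec]
    simp only [hae]
    simp
  have f3 : ∀ β : Fin n → ℝ, DD (∑ c, β c • V c) (DD (∑ c, β c • V c) (DD e u)) x =
      ∑ b, ∑ c, β b * β c * A b c := by
    intro β
    rw [DD_sum_vec2 hΩ hs1 Finset.univ β V _ hx, Finset.sum_comm]
    refine Finset.sum_congr rfl fun c _ => ?_
    rw [DD_sum_vec, Finset.mul_sum]
    exact Finset.sum_congr rfl fun b _ => by rw [hA']; ring
  have f4 : ∀ β : Fin n → ℝ, DD (∑ c, β c • V c) (DD (∑ c, β c • V c) u) x = ∑ c, β c ^ 2 :=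
    frame_bb hΩ hu hx V hV
  have hsingle : ∀ β : Fin n → ℝ, β i0 ^ 2 ≤ ∑ c, β c ^ 2 := fun β =>
    Finset.single_le_sum (f := fun c => β c ^ 2) (fun c _ => sq_nonneg _) (Finset.mem_univ i0)
  have hQ : ∀ β : Fin n → ℝ, ∑ b, ∑ c, β b * β c * A b c ≤ l * ∑ c, β c ^ 2 := by
    intro β
    have := (J (∑ c, β c • V c) 0).2
    simp only [hDz, f1, f2, f3, f4, ← hld, zero_add, mul_zero, sub_zero, zero_div] at this
    have h1 := hsingle β
    set Q := ∑ b, ∑ c, β b * β c * A b c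
    set B2 := ∑ c, β c ^ 2
    have e1 : 3 * (β i0 * l) / l = 3 * β i0 := by field_simp
    rw [e1] at this
    have h2 : 6 * Q / l ≤ 6 * B2 := by nlinarith
    rw [div_le_iff₀ hl0] at h2
    linarith
  have hP : ∑ a, DD (V a) u x ^ 2 ≤ G := by
    have h1 := hG (∑ c, DD (V c) u x • V c)
    rw [f4, DD_sum_vec] at h1
    have h2 : ∑ c, DD (V c) u x * DD (V c) u x = ∑ c, DD (V c) u x ^ 2 :=
      Finset.sum_congr rfl fun c _ => by ring
    rw [h2] at h1
    rcases (Finset.sum_nonneg (s := Finset.univ) fun c (_ : c ∈ Finset.univ) =>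
      sq_nonneg (DD (V c) u x)).eq_or_lt with h3 | h3
    · rw [← h3]; exact hG0
    · rw [sq] at h1
      exact le_of_mul_le_mul_right h1 h3
  obtain ⟨κ, hκ⟩ : ∃ κ, κ = 4 / (R - u x) := ⟨_, rfl⟩
  have hκ0 : 0 < κ := by rw [hκ]; positivity
  have K : ∀ a, 2 / l * (DD (V a) (DD (V a) (DD e (DD e (DD e u)))) x
        - 3 * ∑ c, A a c * DD (V a) (DD (V c) (DD e (DD e u))) x
        + 3 / 2 * ∑ b, ∑ c, A a b * A a c * A b c)
      - κ - 3 / 4 * κ ^ 2 * DD (V a) u x ^ 2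
      - 3 * (DD (V a) (DD (V a) (DD e (DD e u))) x - 3 / 2 * ∑ c, A a c ^ 2) ≤ 0 := by
    intro a
    obtain ⟨J1, J2⟩ := J (∑ c, (-(1 / 2) * A a c) • V c) (V a)
    have b2 : DD (V a) (DD (∑ c, (-(1 / 2) * A a c) • V c) (DD e (DD e u))) x =
        -(1 / 2) * ∑ c, A a c * DD (V a) (DD (V c) (DD e (DD e u))) x := by
      rw [DD_sum_vec2 hΩ hs2 Finset.univ _ V _ hx, Finset.mul_sum]
      exact Finset.sum_congr rfl fun c _ => by ring
    have b4 : DD (V a) (DD (∑ c, (-(1 / 2) * A a c) • V c) (DD e u)) x =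
        -(1 / 2) * ∑ c, A a c ^ 2 := by
      rw [DD_sum_vec2 hΩ hs1 Finset.univ _ V _ hx, Finset.mul_sum]
      exact Finset.sum_congr rfl fun c _ => by rw [hA']; ring
    have b5 : ∑ b, ∑ c, (-(1 / 2) * A a b) * (-(1 / 2) * A a c) * A b c =
        1 / 4 * ∑ b, ∑ c, A a b * A a c * A b c := by
      simp only [Finset.mul_sum]
      exact Finset.sum_congr rfl fun b _ => Finset.sum_congr rfl fun c _ => by ring
    have b6 : ∑ c, (-(1 / 2) * A a c) ^ 2 = 1 / 4 * ∑ c, A a c ^ 2 := by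
      rw [Finset.mul_sum]
      exact Finset.sum_congr rfl fun c _ => by ring
    have b7 : DD (V a) (DD (V a) u) x = 1 := by rw [hV]; simp
    simp only [f1, f2, f3, f4, b2, b4, b5, b6, b7, hA0, ← hld, ← hκ] at J1 J2
    have D1 : A a i0 + 2 * (-(1 / 2) * A a i0) = 0 := by ring
    rw [D1] at J1 J2
    generalize (DD (V a) (DD e (DD e (DD e u))) x + 3 * (-(1 / 2) * A a i0 * l)) / l = N1 at J1 J2
    have F1 : N1 = κ / 2 * DD (V a) u x := by linarith
    rw [F1] at J2
    refine le_trans (le_of_eq ?_) J2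
    have hk2 : (DD (V a) u x / (R - u x)) = κ / 4 * DD (V a) u x := by rw [hκ]; field_simp
    rw [hk2]
    ring
  have hsum := Finset.sum_nonpos (s := Finset.univ) fun a _ => K a
  simp only [Finset.sum_sub_distrib, Finset.sum_add_distrib, ← Finset.mul_sum] at hsum
  simp only [Finset.sum_const, Finset.card_univ, Fintype.card_fin, nsmul_eq_mul] at hsum
  have hB : ∑ a, DD (V a) (DD (V a) (DD e (DD e u))) x = ∑ a, ∑ b, A a b ^ 2 := by
    simp only [hA]; linarith
  have hT3 : ∑ a, ∑ b, ∑ c, A a b * A a c * A b c ≤ l * ∑ a, ∑ b, A a b ^ 2 := by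
    rw [Finset.mul_sum]
    exact Finset.sum_le_sum fun a _ => hQ (A a)
  have hT2 : l ^ 2 ≤ ∑ a, ∑ b, A a b ^ 2 := by
    have h1 : A i0 i0 ^ 2 ≤ ∑ b, A i0 b ^ 2 := hsingle (A i0)
    have h2 : ∑ b, A i0 b ^ 2 ≤ ∑ a, ∑ b, A a b ^ 2 :=
      Finset.single_le_sum (f := fun a => ∑ b, A a b ^ 2)
        (fun a _ => Finset.sum_nonneg fun b _ => sq_nonneg _) (Finset.mem_univ i0)
    rw [hAl i0, if_pos rfl] at h1
    linarith
  have p3' : ∑ a, DD (V a) (DD (V a) (DD e (DD e (DD e u)))) x -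
      3 * ∑ a, ∑ b, A a b * (DD (V a) (DD (V b) (DD e (DD e u))) x) +
      2 * ∑ a, ∑ b, ∑ c, A a b * A a c * A b c = 0 := p3
  rw [hB] at hsum
  set T2 := ∑ a, ∑ b, A a b ^ 2
  set T3 := ∑ a, ∑ b, ∑ c, A a b * A a c * A b c
  set P := ∑ a, DD (V a) u x ^ 2
  have g1 : ∑ a, DD (V a) (DD (V a) (DD e (DD e (DD e u)))) x -
      3 * ∑ a, ∑ b, A a b * (DD (V a) (DD (V b) (DD e (DD e u))) x) + 3 / 2 * T3 = -(1 / 2) * T3 := by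
    linarith
  rw [g1] at hsum
  have g2 : T3 / l ≤ T2 := by rw [div_le_iff₀ hl0]; linarith
  have g3 : 2 / l * (-(1 / 2) * T3) = -(T3 / l) := by ring
  rw [g3] at hsum
  have g4 : l ^ 2 ≤ 3 / 2 * κ ^ 2 * P + 2 * n * κ := by linarith
  have g5 : 3 / 2 * κ ^ 2 * P ≤ 3 / 2 * κ ^ 2 * G := by gcongr
  rw [← hld]
  have g6 : 3 / 2 * κ ^ 2 * G + 2 * n * κ = 24 * G / (R - u x) ^ 2 + 8 * n / (R - u x) := by
    rw [hκ]; field_simp; ring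
  linarith

lemma thirdIIb (hn : 2 ≤ n) (hΩ : IsOpen Ω) (hu : ContDiffOn ℝ (⊤ : ℕ∞) u Ω)
    (hconv : ∀ x ∈ Ω, (hess u x).PosDef) (d0 : ℝ)
    (hpde : ∀ ξ ∈ Ω, (hess u ξ).det = Real.exp (-(∑ i : Fin n, (0 : Fin n → ℝ) i * pd i u ξ) - d0))
    (hproper : ∀ C : ℝ, IsCompact {ξ ∈ Ω | u ξ ≤ C})
    {p : Fin n → ℝ} (hp : p ∈ Ω) (hmin : ∀ y ∈ Ω, u p ≤ u y) :
    ∃ C : ℝ, ∀ ρ > 0, ∀ x ∈ Ω, u x ≤ u p + ρ → ∀ e,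
      (u p + ρ - u x) ^ 4 * DD e (DD e (DD e u)) x ^ 2 ≤ C * ρ ^ 3 * DD e (DD e u) x ^ 3 := by
  obtain ⟨C1, hC1⟩ : ∃ C1 : ℝ, C1 = 2 * n * 2 ^ (2 * n + 1) := ⟨_, rfl⟩
  have hC10 : 0 ≤ C1 := by rw [hC1]; positivity
  refine ⟨24 * C1 + 8 * n, fun ρ hρ => ?_⟩
  have hgrad := gradIIa hn hΩ hu hconv d0 hpde hproper hp hmin hρ
  rw [← hC1] at hgrad
  obtain ⟨R, hRd⟩ : ∃ R, R = u p + ρ := ⟨_, rfl⟩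
  rw [← hRd] at hgrad ⊢
  have hKΩ : {ξ ∈ Ω | u ξ ≤ R} ×ˢ (Set.univ : Set (Fin n → ℝ)) ⊆ Ω ×ˢ Set.univ :=
    Set.prod_mono (fun y hy => hy.1) le_rfl
  obtain ⟨x0, hx0, e1, he1, hmax⟩ := exists_max_quot (n := n) (by omega) (hproper R)
    ⟨p, hp, by linarith⟩ (fun x e => (R - u x) ^ 4 * DD e (DD e (DD e u)) x ^ 2)
    (fun x e => DD e (DD e u) x) 3 (by norm_num)
    (((continuousOn_const.sub (hu.continuousOn.comp continuousOn_fst fun q hq => hq.1)).pow _ |>.mul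
      ((DD3_cont hΩ hu).pow 2)).mono hKΩ) ((DD2_cont hΩ hu).mono hKΩ)
    (fun x hx e he => DD2_pos hΩ hu hconv hx.1 he)
    (fun x hx e r => by simp only [DD3_smul hΩ hu hx.1]; ring)
    (fun x hx e r => DD2_smul hΩ hu hx.1 e r)
  have hD0 : ∀ y ∈ Ω, ∀ e, 0 ≤ DD e (DD e u) y := by
    intro y hy e
    by_cases he : e = 0
    · rw [he, DD_zero_vec]
    · exact (DD2_pos hΩ hu hconv hy he).le
  suffices hM : (R - u x0) ^ 4 * DD e1 (DD e1 (DD e1 u)) x0 ^ 2 ≤ (24 * C1 + 8 * n) * ρ ^ 3 by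
    intro x hx hxR e
    exact (hmax x ⟨hx, hxR⟩ e).trans (mul_le_mul_of_nonneg_right hM (pow_nonneg (hD0 x hx e) 3))
  have hη0 : 0 ≤ R - u x0 := sub_nonneg.2 hx0.2
  rcases hη0.eq_or_lt with h0 | hη
  · rw [← h0, zero_pow (by omega)]
    simp only [zero_mul]; positivity
  by_cases hr0 : DD e1 (DD e1 (DD e1 u)) x0 = 0
  · rw [hr0]; simp only [ne_eq, OfNat.ofNat_ne_zero, not_false_eq_true, zero_pow, mul_zero]
    positivity
  obtain ⟨e, hee, hr, hre⟩ : ∃ e, DD e (DD e u) x0 = 1 ∧ 0 < DD e (DD e (DD e u)) x0 ∧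
      DD e (DD e (DD e u)) x0 ^ 2 = DD e1 (DD e1 (DD e1 u)) x0 ^ 2 := by
    rcases lt_or_gt_of_ne hr0 with h1 | h1
    · refine ⟨(-1 : ℝ) • e1, ?_, ?_, ?_⟩
      · rw [DD2_smul hΩ hu hx0.1]; simpa using he1
      · rw [DD3_smul hΩ hu hx0.1]; linarith
      · rw [DD3_smul hΩ hu hx0.1]; ring
    · exact ⟨e1, he1, h1, rfl⟩
  have hb := ptIIb hn hΩ hu hconv d0 hpde hx0.1 hee hr (R := R) (by linarith) (by
    intro y hy hyR e' h1 h2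
    have h3 := hmax y ⟨hy, hyR.le⟩ e'
    rw [← hre] at h3
    have h4 : 0 < (R - u y) ^ 4 := pow_pos (sub_pos.2 hyR) _
    have h5 : 0 < (R - u x0) ^ 4 := pow_pos hη _
    have h6 := Real.log_le_log (by positivity) h3
    rw [Real.log_mul h4.ne' (by positivity), Real.log_mul (by positivity) (by positivity),
      Real.log_mul h5.ne' (by positivity), Real.log_pow, Real.log_pow, Real.log_pow,
      Real.log_pow, Real.log_pow] at h6
    rw [hee, Real.log_one]
    push_cast at h6
    linarith) (C1 * ρ) (hgrad x0 hx0.1 hx0.2) (by positivity)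
  rw [← hre]
  have hηp : R - u x0 ≤ ρ := by linarith [hmin x0 hx0.1]
  set η := R - u x0
  calc η ^ 4 * DD e (DD e (DD e u)) x0 ^ 2
      ≤ η ^ 4 * (24 * (C1 * ρ) / η ^ 2 + 8 * n / η) := by gcongr
    _ = 24 * C1 * ρ * η ^ 2 + 8 * n * η ^ 3 := by field_simp
    _ ≤ 24 * C1 * ρ * ρ ^ 2 + 8 * n * ρ ^ 3 := by gcongr
    _ = _ := by ring

lemma third_zero (hn : 2 ≤ n) (hΩ : IsOpen Ω) (hne : Ω.Nonempty) (hu : ContDiffOn ℝ (⊤ : ℕ∞) u Ω)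
    (hconv : ∀ x ∈ Ω, (hess u x).PosDef) (d0 : ℝ)
    (hpde : ∀ ξ ∈ Ω, (hess u ξ).det = Real.exp (-(∑ i : Fin n, (0 : Fin n → ℝ) i * pd i u ξ) - d0))
    (hproper : ∀ C : ℝ, IsCompact {ξ ∈ Ω | u ξ ≤ C}) :
    ∀ x ∈ Ω, ∀ e, DD e (DD e (DD e u)) x = 0 := by
  intro x hx e
  obtain ⟨p, hp, hmin⟩ := exists_min hne hu hproper
  obtain ⟨C, hC⟩ := thirdIIb hn hΩ hu hconv d0 hpde hproper hp hmin
  by_contra h0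
  obtain ⟨L, hL⟩ : ∃ L, L = DD e (DD e (DD e u)) x ^ 2 := ⟨_, rfl⟩
  have hL0 : 0 < L := by rw [hL]; positivity
  obtain ⟨M, hM⟩ : ∃ M, M = 16 * C * DD e (DD e u) x ^ 3 := ⟨_, rfl⟩
  obtain ⟨ρ, hρ⟩ : ∃ ρ, ρ = 2 * (u x - u p) + |M| / L + 1 := ⟨_, rfl⟩
  have hxp := hmin x hx
  have hq : 0 ≤ |M| / L := by positivity
  have hρ0 : 0 < ρ := by linarith
  have h1 := hC ρ hρ0 x hx (by linarith) e
  rw [← hL] at h1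
  have h2 : (ρ / 2) ^ 4 ≤ (u p + ρ - u x) ^ 4 := pow_le_pow_left₀ (by positivity) (by linarith) 4
  have h3 := (mul_le_mul_of_nonneg_right h2 hL0.le).trans h1
  have h4 : ρ ^ 3 * (ρ * L) ≤ ρ ^ 3 * M := by rw [hM]; nlinarith
  have h5 := le_of_mul_le_mul_left h4 (by positivity)
  have h6 : |M| / L + 1 ≤ ρ := by linarith
  have h7 : (|M| / L + 1) * L ≤ ρ * L := by gcongr
  have h8 : (|M| / L + 1) * L = |M| + L := by field_simp
  linarith [le_abs_self M]

end stepIIb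

end helpers

/-- If `u` is a smooth strictly convex solution of
`det D²u = exp(−Σ d_i ∂u/∂ξ_i − d_0)` on a convex domain `Ω ⊆ ℝⁿ` all of whose
sublevel sets `{u ≤ C}` are compact subsets of `Ω` (i.e. `u → ∞` at `∂Ω`),
then `Ω = ℝⁿ` and `u` is a quadratic polynomial. -/
theorem quadratic_of_proper_solution_on_convex_domain (n : ℕ) (hn : 2 ≤ n)
    (Ω : Set (Fin n → ℝ)) (hΩo : IsOpen Ω) (hΩc : Convex ℝ Ω) (hΩne : Ω.Nonempty)
    (u : (Fin n → ℝ) → ℝ) (hu : ContDiffOn ℝ (⊤ : ℕ∞) u Ω)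
    (hconv : ∀ x ∈ Ω, (hess u x).PosDef)
    (d : Fin n → ℝ) (d0 : ℝ)
    (hpde : ∀ ξ ∈ Ω,
      (hess u ξ).det = Real.exp (-(∑ i : Fin n, d i * pd i u ξ) - d0))
    (hproper : ∀ C : ℝ, IsCompact {ξ ∈ Ω | u ξ ≤ C}) :
    Ω = Set.univ ∧
      ∃ (Q : Matrix (Fin n) (Fin n) ℝ) (b : Fin n → ℝ) (c : ℝ),
        ∀ ξ ∈ Ω,
          u ξ = (∑ i : Fin n, ∑ j : Fin n, Q i j * ξ i * ξ j)
            + (∑ i : Fin n, b i * ξ i) + c := by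
  have hd := d_eq_zero hn hΩo hΩne hu hconv d d0 hpde hproper
  subst hd
  exact conclusion hΩo hΩc hΩne hu
    (third_zero hn hΩo hΩne hu hconv d0 hpde hproper) hproper
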